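/- arXiv:2508.08388 — 3 statements merged into one kernel-verified Lean document; each statement's English description precedes it below -/
import Mathlib

section
/- Let (W,S) be a Coxeter system, w ∈ FC(W), and suppose s ∈ D_L(w), t ∈ S with m_{s,t} ≥ 3, and tw ∉ FC(W). Then st is a prefix of w, i.e. there exists v with w = stv and ℓ(w) = ℓ(v) + 2. -/
open CoxeterSystem

namespace CoxFC


open CoxeterSystem


variable {B : Type*} {W : Type*} [Group W] {M : CoxeterMatrix B}

/-- One commutation move: swap two adjacent commuting letters. -/
def CommStep (M : CoxeterMatrix B) (l l' : List B) : Prop :=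
  ∃ (l₁ l₂ : List B) (a b : B), M a b = 2 ∧
    l = l₁ ++ a :: b :: l₂ ∧ l' = l₁ ++ b :: a :: l₂

/-- Two words are commutation equivalent if related by a sequence of commutation moves. -/
def CommEquiv (M : CoxeterMatrix B) : List B → List B → Prop :=
  Relation.ReflTransGen (CommStep M)

/-- A fully commutative element: any two reduced expressions are commutation equivalent. -/
def IsFC (cs : CoxeterSystem M W) (w : W) : Prop :=
  ∀ l l' : List B, cs.IsReduced l → cs.IsReduced l' →
    cs.wordProd l = w → cs.wordProd l' = w → CommEquiv M l l'

/-- `m s t ≥ 3`, where a matrix entry `0` denotes `∞`. -/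
def Big (M : CoxeterMatrix B) (s t : B) : Prop := 3 ≤ M s t ∨ M s t = 0

/-- `w` is left star reducible by `s` with respect to `t`. -/
def IsLeftStarReducible (cs : CoxeterSystem M W) (s t : B) (w : W) : Prop :=
  Big M s t ∧ cs.IsLeftDescent w s ∧ cs.IsLeftDescent (cs.simple s * w) t

/-- `w` is right star reducible by `s` with respect to `t`. -/
def IsRightStarReducible (cs : CoxeterSystem M W) (s t : B) (w : W) : Prop :=
  Big M s t ∧ cs.IsRightDescent w s ∧ cs.IsRightDescent (w * cs.simple s) t

/-- A single left star reduction step from `w` to `v`. -/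
def LeftStarStep (cs : CoxeterSystem M W) (w v : W) : Prop :=
  ∃ s t : B, IsLeftStarReducible cs s t w ∧ v = cs.simple s * w

/-- A single (left or right) star reduction step from `w` to `v`. -/
def StarStep (cs : CoxeterSystem M W) (w v : W) : Prop :=
  ∃ s t : B, (IsLeftStarReducible cs s t w ∧ v = cs.simple s * w) ∨
    (IsRightStarReducible cs s t w ∧ v = w * cs.simple s)

/-- `w` admits no left star reduction. -/
def LeftStarIrreducible (cs : CoxeterSystem M W) (w : W) : Prop :=
  ∀ s t : B, ¬ IsLeftStarReducible cs s t w

/-- `w` admits no star reduction at all. -/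
def StarIrreducible (cs : CoxeterSystem M W) (w : W) : Prop :=
  ∀ s t : B, ¬ IsLeftStarReducible cs s t w ∧ ¬ IsRightStarReducible cs s t w

/-- A product of pairwise commuting generators (including the identity). -/
def IsCC (cs : CoxeterSystem M W) (w : W) : Prop :=
  ∃ l : List B, cs.IsReduced l ∧ cs.wordProd l = w ∧
    ∀ a ∈ l, ∀ b ∈ l, a ≠ b → M a b = 2

/-- The support of `w`: generators appearing in some reduced expression. -/
def Supp (cs : CoxeterSystem M W) (w : W) : Set B :=
  {a | ∃ l : List B, cs.IsReduced l ∧ cs.wordProd l = w ∧ a ∈ l}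

/-- `us` is the Cartier–Foata normal form of `w`, presented as a list of words,
each a product of pairwise commuting generators. -/
def IsCFNF (cs : CoxeterSystem M W) (w : W) (us : List (List B)) : Prop :=
  (∀ l ∈ us, l ≠ []) ∧
  cs.wordProd us.flatten = w ∧
  cs.IsReduced us.flatten ∧
  (∀ l ∈ us, ∀ a ∈ l, ∀ b ∈ l, a ≠ b → M a b = 2) ∧
  (∀ a : B, (∃ l ∈ us.head?, a ∈ l) ↔ cs.IsLeftDescent w a) ∧
  (∀ j : ℕ, j + 1 < us.length → ∀ t ∈ us.getD (j+1) [],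
      ∃ s ∈ us.getD j [], Big M s t)



section Helpers

open Polynomial.Chebyshev

/-- Entry of the (negated, doubled) Coxeter form. -/
noncomputable def kk (M : CoxeterMatrix B) (i j : B) : ℝ :=
  if M i j = 0 then 2 else 2 * Real.cos (Real.pi / M i j)

lemma kk_self (M : CoxeterMatrix B) (i : B) : kk M i i = -2 := by
  simp [kk]

lemma kk_symm (M : CoxeterMatrix B) (i j : B) : kk M i j = kk M j i := by
  simp [kk, M.symmetric i j]

lemma kk_eq_zero {M : CoxeterMatrix B} {i j : B} (hij : i ≠ j) (h : kk M i j = 0) : M i j = 2 := by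
  unfold kk at h
  split_ifs at h with h0
  · norm_num at h
  · by_contra h2
    have h1 := M.off_diagonal i j hij
    have h3 : 3 ≤ M i j := by
      have : M i j ≠ 1 := h1
      omega
    have h3' : (3 : ℝ) ≤ (M i j : ℝ) := by exact_mod_cast h3
    have : 0 < Real.cos (Real.pi / M i j) := by
      apply Real.cos_pos_of_mem_Ioo
      have hp := Real.pi_pos
      constructor
      · have : 0 < Real.pi / M i j := by positivity
        linarith
      · rw [div_lt_div_iff₀ (by linarith) (by norm_num)]
        nlinarith
    linarith

/-- The functional defining the reflection. -/
noncomputable def ff (M : CoxeterMatrix B) (i : B) : Module.Dual ℝ (B →₀ ℝ) :=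
  Finsupp.linearCombination ℝ (fun j => - kk M i j)

lemma ff_single (M : CoxeterMatrix B) (i j : B) :
    ff M i (Finsupp.single j 1) = - kk M i j := by
  simp [ff]

lemma ff_self (M : CoxeterMatrix B) (i : B) :
    ff M i (Finsupp.single i 1) = 2 := by
  simp [ff_single, kk_self]

noncomputable def sig (M : CoxeterMatrix B) (i : B) : (B →₀ ℝ) ≃ₗ[ℝ] (B →₀ ℝ) :=
  Module.reflection (ff_self M i)

lemma sig_single (M : CoxeterMatrix B) (i j : B) :
    sig M i (Finsupp.single j 1) = Finsupp.single j 1 + kk M i j • Finsupp.single i 1 := by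
  rw [sig, Module.reflection_apply, ff_single]
  simp

lemma sig_liftable (M : CoxeterMatrix B) : M.IsLiftable (sig M) := by
  intro i j
  by_cases hij : i = j
  · subst hij
    rw [M.diagonal, pow_one]
    have := mul_inv_cancel (sig M i)
    rwa [show (sig M i)⁻¹ = sig M i from Module.reflection_inv _] at this
  by_cases h0 : M i j = 0
  · rw [h0, pow_zero]
  have h1 : M i j ≠ 1 := M.off_diagonal i j hij
  have hk : kk M i j = 2 * Real.cos (Real.pi / M i j) := by simp [kk, h0]
  refine LinearEquiv.ext fun z => ?_
  rw [show (1 : (B →₀ ℝ) ≃ₗ[ℝ] (B →₀ ℝ)) z = z from rfl]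
  unfold sig
  have ht : 2 * Real.cos (2 * Real.pi / M i j) =
      ff M i (Finsupp.single j 1) * ff M j (Finsupp.single i 1) - 2 := by
    rw [ff_single, ff_single, kk_symm M j i, hk, mul_div_assoc, Real.cos_two_mul]
    ring
  rw [Module.reflection_mul_reflection_pow_apply _ _ _ _ _ ht]
  by_cases h2 : M i j = 2
  · have hk0 : kk M i j = 0 := by rw [hk, h2]; simp
    rw [h2]
    simp only [ff_single, kk_symm M j i, hk0]
    have : 2 * Real.cos (2 * Real.pi / (2 : ℕ)) = -2 := by
      simp
    rw [this]
    norm_num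
    module
  have h3 : 3 ≤ M i j := by omega
  have h3' : (3 : ℝ) ≤ (M i j : ℝ) := by exact_mod_cast h3
  have hs : Real.sin (2 * Real.pi / M i j) ≠ 0 := by
    apply ne_of_gt
    apply Real.sin_pos_of_pos_of_lt_pi
    · have := Real.pi_pos; positivity
    · rw [div_lt_iff₀ (by linarith)]; nlinarith [Real.pi_pos]
  have hm : (M i j : ℝ) * (2 * Real.pi / M i j) = 2 * Real.pi := by
    field_simp
  have hS := fun n : ℤ => S_two_mul_real_cos (2 * Real.pi / M i j) n
  generalize 2 * Real.pi / (M i j : ℝ) = θ at *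
  generalize M i j = m at *
  obtain ⟨k, rfl | rfl⟩ := Nat.even_or_odd' m
  · have e1 : (((2 * k : ℕ) : ℤ) - 2) / 2 = k - 1 := by omega
    have e2 : (((2 * k : ℕ) : ℤ) - 1) / 2 = k - 1 := by omega
    have : (S ℝ ((k : ℤ) - 1)).eval (2 * Real.cos θ) = 0 := by
      have := hS (k - 1)
      apply (mul_eq_zero.1 (this.trans _)).resolve_right hs
      have : (((k - 1 : ℤ) : ℝ) + 1) * θ = Real.pi := by push_cast at hm ⊢; linarith
      rw [this, Real.sin_pi]
    rw [e1, e2, this]; simp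
  · have e1 : (((2 * k + 1 : ℕ) : ℤ) - 2) / 2 = k - 1 := by omega
    have e2 : (((2 * k + 1 : ℕ) : ℤ) - 1) / 2 = k := by omega
    have e3 : (((2 * k + 1 : ℕ) : ℤ) - 3) / 2 = k - 1 := by omega
    have e4 : (((2 * k + 1 : ℕ) : ℤ)) / 2 = k := by omega
    have : (S ℝ (k : ℤ)).eval (2 * Real.cos θ) + (S ℝ ((k : ℤ) - 1)).eval (2 * Real.cos θ) = 0 := by
      have a := hS (k - 1)
      have b := hS k
      refine (mul_eq_zero.1 (?_ : _ * Real.sin θ = 0)).resolve_right hs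
      rw [add_mul, a, b]
      have : (((k : ℤ) : ℝ) + 1) * θ = 2 * Real.pi - (((k - 1 : ℤ) : ℝ) + 1) * θ := by
        push_cast at hm ⊢; linarith
      rw [this, Real.sin_two_pi_sub]; ring
    rw [e1, e2, e3, e4, this]; simp

lemma simple_inj (cs : CoxeterSystem M W) {i j : B} (h : cs.simple i = cs.simple j) : i = j := by
  by_contra hij
  have h1 := congrArg (cs.lift ⟨sig M, sig_liftable M⟩) h
  rw [cs.lift_apply_simple, cs.lift_apply_simple] at h1
  have h2 := congrArg (fun g => (g (Finsupp.single i 1)) i) h1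
  simp only [sig_single, kk_self] at h2
  simp [Ne.symm hij] at h2
  try norm_num at h2

lemma comm_imp (cs : CoxeterSystem M W) {i j : B} (hij : i ≠ j)
    (h : cs.simple i * cs.simple j = cs.simple j * cs.simple i) : M i j = 2 := by
  have h1 := congrArg (cs.lift ⟨sig M, sig_liftable M⟩) h
  rw [map_mul, map_mul, cs.lift_apply_simple, cs.lift_apply_simple] at h1
  have h2 := congrArg (fun g => (g (Finsupp.single i 1)) j) h1
  simp only [LinearEquiv.mul_apply, sig_single, kk_self, map_add, map_smul] at h2
  simp [hij] at h2
  apply kk_eq_zero hij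
  have := kk_symm M i j
  linarith

open Classical in
/-- The signed permutation attached to a generator. -/
noncomputable def pfun (cs : CoxeterSystem M W) (i : B) (x : W × ZMod 2) : W × ZMod 2 :=
  (cs.simple i * x.1 * cs.simple i, x.2 + if x.1 = cs.simple i then 1 else 0)

open Classical in
lemma pfun_invol (cs : CoxeterSystem M W) (i : B) : Function.Involutive (pfun cs i) := by
  rintro ⟨x, e⟩
  have h : (cs.simple i * x * cs.simple i = cs.simple i) ↔ x = cs.simple i := by
    constructor
    · intro h
      have := congrArg (fun y => cs.simple i * y * cs.simple i) h
      simpa [mul_assoc] using this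
    · rintro rfl; simp
  ext
  · simp [pfun, mul_assoc]
  · change e + (if x = cs.simple i then 1 else 0) +
      (if cs.simple i * x * cs.simple i = cs.simple i then 1 else 0) = e
    by_cases hx : x = cs.simple i
    · rw [if_pos hx, if_pos (h.2 hx), add_assoc, CharTwo.add_self_eq_zero, add_zero]
    · rw [if_neg hx, if_neg (fun a => hx (h.1 a)), add_zero, add_zero]

noncomputable def pp (cs : CoxeterSystem M W) (i : B) : Equiv.Perm (W × ZMod 2) :=
  (pfun_invol cs i).toPerm

open Classical in
lemma pp_apply (cs : CoxeterSystem M W) (i : B) (x : W) (e : ZMod 2) :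
    pp cs i (x, e) = (cs.simple i * x * cs.simple i, e + if x = cs.simple i then 1 else 0) := rfl

open Classical in
lemma pp_pow (cs : CoxeterSystem M W) (i j : B) (k : ℕ) (x : W) (e : ZMod 2) :
    ((pp cs i * pp cs j) ^ k) (x, e) =
      ((cs.simple i * cs.simple j) ^ k * x * ((cs.simple i * cs.simple j) ^ k)⁻¹,
        e + ∑ b ∈ Finset.range (2 * k),
          if x = cs.simple j * (cs.simple i * cs.simple j) ^ b then 1 else 0) := by
  induction k with
  | zero => simp
  | succ k ih =>
    have hc : cs.simple j * (cs.simple i * cs.simple j) * cs.simple j =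
        (cs.simple i * cs.simple j)⁻¹ := by simp [mul_assoc]
    have hcj : ∀ n : ℕ, cs.simple j * (cs.simple i * cs.simple j) ^ n =
        ((cs.simple i * cs.simple j) ^ n)⁻¹ * cs.simple j := by
      intro n
      induction n with
      | zero => simp
      | succ n ihn =>
        have : cs.simple j * (cs.simple i * cs.simple j) =
          (cs.simple i * cs.simple j)⁻¹ * cs.simple j := by simp [mul_assoc]
        rw [pow_succ', ← mul_assoc, this, mul_assoc, ihn, ← mul_assoc, ← mul_inv_rev, ← pow_succ,
          ← pow_succ']
    rw [pow_succ', Equiv.Perm.mul_apply, ih, Equiv.Perm.mul_apply, pp_apply, pp_apply]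
    have h1 : ((cs.simple i * cs.simple j) ^ k * x * ((cs.simple i * cs.simple j) ^ k)⁻¹
        = cs.simple j) ↔ x = cs.simple j * (cs.simple i * cs.simple j) ^ (2 * k) := by
      rw [two_mul, pow_add, ← mul_assoc, hcj, mul_inv_eq_iff_eq_mul, mul_assoc, ← eq_inv_mul_iff_mul_eq]
    have h2 : (cs.simple j * ((cs.simple i * cs.simple j) ^ k * x *
        ((cs.simple i * cs.simple j) ^ k)⁻¹) * cs.simple j
        = cs.simple i) ↔ x = cs.simple j * (cs.simple i * cs.simple j) ^ (2 * k + 1) := by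
      have : cs.simple j * (cs.simple i * cs.simple j) ^ (2 * k + 1) =
          ((cs.simple i * cs.simple j) ^ k)⁻¹ * cs.simple j * (cs.simple i * cs.simple j) *
            (cs.simple i * cs.simple j) ^ k := by
        rw [← hcj, mul_assoc, mul_assoc, ← pow_succ', ← pow_add]
        congr 2; ring
      rw [this]
      generalize (cs.simple i * cs.simple j) ^ k = c
      constructor
      · intro h
        have := congrArg (fun y => c⁻¹ * (cs.simple j * y * cs.simple j) * c) h
        simpa [mul_assoc] using this
      · rintro rfl
        simp [mul_assoc]
    ext
    · simp [pow_succ', mul_assoc]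
    · simp only [h1, h2]
      rw [show 2 * (k + 1) = 2 * k + 1 + 1 by ring, Finset.sum_range_succ, Finset.sum_range_succ]
      simp only [add_assoc]

lemma pp_liftable (cs : CoxeterSystem M W) : M.IsLiftable (pp cs) := by
  classical
  intro i j
  ext1 ⟨x, e⟩
  rw [pp_pow, cs.simple_mul_simple_pow, two_mul, Finset.sum_range_add]
  simp only [pow_add, cs.simple_mul_simple_pow, one_mul]
  simp [CharTwo.add_self_eq_zero]

open Classical in
lemma pp_word (cs : CoxeterSystem M W) (ω : List B) (x : W) (e : ZMod 2) :
    cs.lift ⟨pp cs, pp_liftable cs⟩ (cs.wordProd ω) (x, e) =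
      (cs.wordProd ω * x * (cs.wordProd ω)⁻¹, e + ((cs.rightInvSeq ω).count x : ZMod 2)) := by
  induction ω with
  | nil => simp
  | cons i ω ih =>
    rw [cs.wordProd_cons, map_mul, Equiv.Perm.mul_apply, ih, cs.lift_apply_simple, pp_apply]
    have h : (cs.wordProd ω * x * (cs.wordProd ω)⁻¹ = cs.simple i) ↔
        ((cs.wordProd ω)⁻¹ * cs.simple i * cs.wordProd ω = x) := by
      constructor
      · intro h; rw [← h]; group
      · rintro rfl; group
    ext
    · simp [mul_assoc]
    · simp only [h, CoxeterSystem.rightInvSeq, List.count_cons, beq_iff_eq]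
      push_cast
      rw [add_assoc]

lemma exch_right (cs : CoxeterSystem M W) (ω : List B) (r : B)
    (h : cs.IsRightDescent (cs.wordProd ω) r) : cs.simple r ∈ cs.rightInvSeq ω := by
  classical
  obtain ⟨ω', hω', he⟩ := cs.exists_isReduced (cs.wordProd ω * cs.simple r)
  have hw : cs.wordProd (ω'.concat r) = cs.wordProd ω := by
    rw [cs.wordProd_concat, ← he]; simp
  have hr : cs.IsReduced (ω'.concat r) := by
    have h1 := cs.isRightDescent_iff.1 h
    unfold CoxeterSystem.IsReduced at hω' ⊢
    rw [hw, ← h1, he, hω']; simp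
  have hmem : cs.simple r ∈ cs.rightInvSeq (ω'.concat r) := by
    rw [cs.rightInvSeq_concat]; simp
  have hc := List.count_eq_one_of_mem hr.nodup_rightInvSeq hmem
  have e1 := pp_word cs (ω'.concat r) (cs.simple r) 0
  rw [hw, pp_word cs ω, hc] at e1
  have e2 := congrArg Prod.snd e1
  simp only [zero_add, Nat.cast_one] at e2
  by_contra hn
  rw [List.count_eq_zero_of_not_mem hn] at e2
  simp at e2

lemma exch_left (cs : CoxeterSystem M W) (ω : List B) (r : B)
    (h : cs.IsLeftDescent (cs.wordProd ω) r) : cs.simple r ∈ cs.leftInvSeq ω := by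
  have h1 : cs.IsRightDescent (cs.wordProd ω.reverse) r := by
    rw [cs.wordProd_reverse]; exact cs.isRightDescent_inv_iff.2 h
  have := exch_right cs _ r h1
  rw [cs.rightInvSeq_reverse] at this
  simpa using this

lemma lis_erase (cs : CoxeterSystem M W) (v : List B) (u : W) (h : u ∈ cs.leftInvSeq v) :
    ∃ v' : List B, v'.length + 1 = v.length ∧ u * cs.wordProd v = cs.wordProd v' := by
  obtain ⟨j, hj, rfl⟩ := List.mem_iff_getElem.1 h
  refine ⟨v.eraseIdx j, ?_, ?_⟩
  · have : j < v.length := by simpa using hj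
    rw [List.length_eraseIdx_of_lt this]; omega
  · rw [← cs.getD_leftInvSeq_mul_wordProd, List.getD_eq_getElem _ _ hj]

/-- A left descent can be put in front of a reduced word. -/
lemma desc_word (cs : CoxeterSystem M W) {w : W} {r : B} (h : cs.IsLeftDescent w r) :
    ∃ v, cs.IsReduced (r :: v) ∧ cs.wordProd (r :: v) = w := by
  obtain ⟨v, hv, he⟩ := cs.exists_isReduced (cs.simple r * w)
  have hw : cs.wordProd (r :: v) = w := by rw [cs.wordProd_cons, ← he]; simp
  refine ⟨v, ?_, hw⟩
  unfold CoxeterSystem.IsReduced at hv ⊢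
  rw [hw, ← cs.isLeftDescent_iff.1 h, he, hv]; simp

lemma red_cons_desc (cs : CoxeterSystem M W) {r : B} {v : List B} (h : cs.IsReduced (r :: v)) :
    cs.IsLeftDescent (cs.wordProd (r :: v)) r := by
  unfold CoxeterSystem.IsLeftDescent
  rw [h.eq, cs.wordProd_cons]
  have := cs.length_wordProd_le v
  simp; omega

lemma red_tail (cs : CoxeterSystem M W) {r : B} {v : List B} (h : cs.IsReduced (r :: v)) :
    cs.IsReduced v := by
  simpa using h.drop 1

lemma two_step (cs : CoxeterSystem M W) {w : W} {r t : B} (hrt : r ≠ t)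
    (hr : cs.IsLeftDescent w r) (ht : cs.IsLeftDescent w t) :
    ∃ v, cs.IsReduced (t :: r :: v) ∧ cs.wordProd (t :: r :: v) = w := by
  obtain ⟨v, hv, rfl⟩ := desc_word cs hr
  have h := exch_left cs _ t ht
  simp only [CoxeterSystem.leftInvSeq, List.mem_cons, List.mem_map] at h
  rcases h with h | ⟨u, hu, h⟩
  · exact absurd (simple_inj cs h).symm hrt
  obtain ⟨v', hl, he⟩ := lis_erase cs v u hu
  have hw : cs.wordProd (t :: r :: v') = cs.wordProd (r :: v) := by
    simp only [cs.wordProd_cons, ← he, ← h]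
    simp [mul_assoc]
    rw [← mul_assoc, (cs.isReflection_of_mem_leftInvSeq _ hu).mul_self, one_mul]
  refine ⟨v', ?_, hw⟩
  have := hv.eq
  unfold CoxeterSystem.IsReduced
  rw [hw, this]; simp; omega

lemma three_step (cs : CoxeterSystem M W) {w : W} {r t : B} (hrt : r ≠ t) (hm : M r t ≠ 2)
    (hr : cs.IsLeftDescent w r) (ht : cs.IsLeftDescent w t) :
    ∃ v, cs.IsReduced (t :: r :: t :: v) ∧ cs.wordProd (t :: r :: t :: v) = w := by
  obtain ⟨v, hv, rfl⟩ := two_step cs hrt.symm ht hr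
  have h := exch_left cs _ t ht
  simp only [CoxeterSystem.leftInvSeq, List.mem_cons, List.mem_map] at h
  rcases h with h | ⟨u, hu, h⟩
  · exact absurd (simple_inj cs h).symm hrt
  rcases hu with rfl | ⟨u, hu, rfl⟩
  · exfalso
    apply hm
    apply comm_imp cs hrt
    simp only [MulAut.conj_apply, cs.inv_simple] at h
    nth_rw 2 [← h]
    simp [mul_assoc]
  obtain ⟨v', hl, he⟩ := lis_erase cs v u hu
  have hw : cs.wordProd (t :: r :: t :: v') = cs.wordProd (r :: t :: v) := by
    simp only [cs.wordProd_cons, ← he]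
    nth_rw 1 [← h]
    simp [mul_assoc]
    rw [← mul_assoc, (cs.isReflection_of_mem_leftInvSeq _ hu).mul_self, one_mul]
  refine ⟨v', ?_, hw⟩
  have := hv.eq
  unfold CoxeterSystem.IsReduced
  rw [hw, this]; simp; omega

lemma commStep_symm {l l' : List B} (h : CommStep M l l') : CommStep M l' l := by
  obtain ⟨a, b, x, y, hm, h1, h2⟩ := h
  exact ⟨a, b, y, x, by rw [M.symmetric, hm], h2, h1⟩

lemma commEquiv_symm {l l' : List B} (h : CommEquiv M l l') : CommEquiv M l' l :=
by
  induction h with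
  | refl => exact .refl
  | tail _ hs ih => exact .head (commStep_symm hs) ih

lemma commEquiv_cons (r : B) {l l' : List B} (h : CommEquiv M l l') :
    CommEquiv M (r :: l) (r :: l') := by
  refine Relation.ReflTransGen.lift (r :: ·) ?_ _ _ h
  rintro _ _ ⟨a, b, x, y, hm, rfl, rfl⟩
  exact ⟨r :: a, b, x, y, hm, rfl, rfl⟩

open Classical in
lemma commEquiv_erase (r : B) {l l' : List B} (h : CommEquiv M l l') :
    CommEquiv M (l.erase r) (l'.erase r) := by
  induction h with
  | refl => exact .refl
  | tail _ hs ih =>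
    refine ih.trans ?_
    obtain ⟨a, b, x, y, hm, rfl, rfl⟩ := hs
    have hxy : x ≠ y := by rintro rfl; simp at hm
    by_cases hr : r ∈ a
    · rw [List.erase_append_left _ hr, List.erase_append_left _ hr]
      exact .single ⟨_, b, x, y, hm, rfl, rfl⟩
    · rw [List.erase_append_right _ hr, List.erase_append_right _ hr]
      by_cases hx : x = r
      · subst hx
        simp [List.erase_cons, hxy.symm, CommEquiv]
        exact .refl
      · by_cases hy : y = r
        · subst hy
          simp [List.erase_cons, hxy, CommEquiv]
          exact .refl
        · simp only [List.erase_cons, beq_iff_eq, hx, hy, if_false]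
          exact .single ⟨a, _, x, y, hm, rfl, rfl⟩

lemma commEquiv_cancel (r : B) {l l' : List B} (h : CommEquiv M (r :: l) (r :: l')) :
    CommEquiv M l l' := by
  classical
  simpa using commEquiv_erase r h

open Classical in
lemma commEquiv_filter {r t : B} (hm : M r t ≠ 2) {l l' : List B} (h : CommEquiv M l l') :
    l.filter (fun x => x = r ∨ x = t) = l'.filter (fun x => x = r ∨ x = t) := by
  induction h with
  | refl => rfl
  | tail _ hs ih =>
    rw [ih]
    obtain ⟨a, b, x, y, hxy, rfl, rfl⟩ := hs
    have hne : x ≠ y := by rintro rfl; simp at hxy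
    have hm' : M t r ≠ 2 := by rwa [M.symmetric]
    by_cases hx : x = r ∨ x = t <;> by_cases hy : y = r ∨ y = t
    · exfalso
      rcases hx with rfl | rfl <;> rcases hy with rfl | rfl <;> first | exact hne rfl | exact hm hxy | exact hm' hxy
    all_goals simp [List.filter_cons, hx, hy]

lemma fc_desc_comm (cs : CoxeterSystem M W) {w : W} (hw : IsFC cs w) {r t : B} (hrt : r ≠ t)
    (hr : cs.IsLeftDescent w r) (ht : cs.IsLeftDescent w t) : M r t = 2 := by
  classical
  by_contra hm
  obtain ⟨x, hx, ex⟩ := desc_word cs hr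
  obtain ⟨y, hy, ey⟩ := desc_word cs ht
  have := commEquiv_filter hm (hw _ _ hx hy ex ey)
  simp [List.filter_cons] at this
  exact hrt this.1

lemma cons_red (cs : CoxeterSystem M W) {w : W} {r : B} {l : List B}
    (hr : cs.IsLeftDescent w r) (hl : cs.IsReduced l) (e : cs.wordProd l = cs.simple r * w) :
    cs.IsReduced (r :: l) ∧ cs.wordProd (r :: l) = w := by
  have hw : cs.wordProd (r :: l) = w := by rw [cs.wordProd_cons, e]; simp
  refine ⟨?_, hw⟩
  unfold CoxeterSystem.IsReduced at hl ⊢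
  rw [hw, ← cs.isLeftDescent_iff.1 hr, ← e, hl]; simp

lemma fc_suffix (cs : CoxeterSystem M W) {w : W} (hw : IsFC cs w) {r : B}
    (hr : cs.IsLeftDescent w r) : IsFC cs (cs.simple r * w) := by
  intro l l' hl hl' e e'
  obtain ⟨a, b⟩ := cons_red cs hr hl e
  obtain ⟨a', b'⟩ := cons_red cs hr hl' e'
  exact commEquiv_cancel r (hw _ _ a a' b b')

lemma big_ne {s t : B} (hm : Big M s t) : s ≠ t ∧ M s t ≠ 2 := by
  constructor
  · rintro rfl
    rcases hm with h | h <;> simp at h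
  · intro h2; rcases hm with h | h <;> omega

lemma main_aux (cs : CoxeterSystem M W) (s t : B) (hm : Big M s t) (n : ℕ) :
    ∀ w : W, cs.length w = n → IsFC cs w → cs.IsLeftDescent w s →
      ¬ IsFC cs (cs.simple t * w) →
      ∃ v, cs.IsReduced (s :: t :: v) ∧ cs.wordProd (s :: t :: v) = w := by
  induction n with
  | zero =>
    intro w h0 _ hs
    exact absurd hs (by unfold CoxeterSystem.IsLeftDescent; omega)
  | succ n ih =>
    intro w hn hw hs hnot
    obtain ⟨hst, hst2⟩ := big_ne hm
    have htw : ¬ cs.IsLeftDescent w t := fun h => hst2 (fc_desc_comm cs hw hst hs h)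
    have htt : cs.IsLeftDescent (cs.simple t * w) t := by
      rw [cs.isLeftDescent_iff_not_isLeftDescent_mul]
      simpa using htw
    have hcan : cs.simple t * (cs.simple t * w) = w := by simp
    obtain ⟨l0, hl0, e0⟩ := cs.exists_isReduced w
    -- a reduced word not commutation equivalent to `t :: l0`
    have hex : ∃ l', cs.IsReduced l' ∧ cs.wordProd l' = cs.simple t * w ∧
        ¬ CommEquiv M (t :: l0) l' := by
      by_contra hcon
      push Not at hcon
      exact hnot fun a b ha hb ea eb =>
        (commEquiv_symm (hcon a ha ea)).trans (hcon b hb eb)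
    obtain ⟨l', hl', e', hne⟩ := hex
    obtain _ | ⟨r, l1⟩ := l'
    · exfalso
      have : cs.length (cs.simple t * w) = 0 := by rw [← e']; simp
      unfold CoxeterSystem.IsLeftDescent at htt
      omega
    have hrt : r ≠ t := by
      rintro rfl
      apply hne
      apply commEquiv_cons
      refine hw _ _ hl0 (red_tail cs hl') e0.symm ?_
      rw [cs.wordProd_cons] at e'
      exact mul_left_cancel e'
    have hrd : cs.IsLeftDescent (cs.simple t * w) r := by
      rw [← e']; exact red_cons_desc cs hl'
    by_cases h2 : M r t = 2
    · have hrs : r ≠ s := by rintro rfl; exact hst2 h2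
      obtain ⟨v, hv, ev⟩ := two_step cs hrt hrd htt
      have evw : cs.wordProd (r :: v) = w := by
        rw [cs.wordProd_cons] at ev; exact mul_left_cancel ev
      have hrv := red_tail cs hv
      have hrw : cs.IsLeftDescent w r := by rw [← evw]; exact red_cons_desc cs hrv
      have hrs2 := fc_desc_comm cs hw hrs hrw hs
      obtain ⟨y, hy, ey⟩ := two_step cs hrs.symm hs hrw
      have eyw : cs.wordProd (s :: y) = cs.simple r * w := by
        rw [← ey, cs.wordProd_cons r]; simp
      have hvw : cs.wordProd v = cs.simple r * w := by
        rw [← evw, cs.wordProd_cons r]; simp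
      have hcomm : cs.simple r * cs.simple t = cs.simple t * cs.simple r := by
        have := cs.simple_mul_simple_pow r t
        rw [h2, pow_two] at this
        have := eq_inv_of_mul_eq_one_left this
        simpa using this
      have hcomm' : cs.simple r * cs.simple s = cs.simple s * cs.simple r := by
        have := cs.simple_mul_simple_pow r s
        rw [hrs2, pow_two] at this
        have := eq_inv_of_mul_eq_one_left this
        simpa using this
      obtain ⟨z, hz, ez⟩ := ih (cs.simple r * w)
        (by have := cs.isLeftDescent_iff.1 hrw; omega) (fc_suffix cs hw hrw)
        (by rw [← eyw]; exact red_cons_desc cs (red_tail cs hy)) (by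
          intro hfc
          apply hne
          have c1 : CommEquiv M (t :: l0) (t :: r :: v) :=
            commEquiv_cons t (hw _ _ hl0 hrv e0.symm evw)
          have c2 : CommEquiv M (t :: r :: v) (r :: t :: v) :=
            .single ⟨[], v, t, r, by rw [M.symmetric, h2], rfl, rfl⟩
          have e1 : cs.wordProd l1 = cs.simple t * (cs.simple r * w) := by
            rw [cs.wordProd_cons] at e'
            rw [← mul_assoc, ← hcomm, mul_assoc, ← e']; simp
          have e2 : cs.wordProd (t :: v) = cs.simple t * (cs.simple r * w) := by
            rw [cs.wordProd_cons, hvw]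
          have hred : cs.IsReduced (t :: v) := by
            have a1 := (red_tail cs hl').eq
            have a2 := hl'.eq
            have a3 := hv.eq
            rw [e'] at a2
            rw [ev] at a3
            unfold CoxeterSystem.IsReduced
            rw [e2, ← e1, a1]
            simp at a2 a3 ⊢
            omega
          exact (c1.trans c2).trans
            (commEquiv_cons r (hfc _ _ hred (red_tail cs hl') e2 e1)))
      have ew : cs.wordProd (s :: t :: r :: z) = w := by
        simp only [cs.wordProd_cons] at ez ⊢
        rw [← mul_assoc (cs.simple t), ← hcomm, mul_assoc, ← mul_assoc, ← hcomm', mul_assoc, ez]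
        simp
      refine ⟨r :: z, ?_, ew⟩
      have a1 := hz.eq
      have a2 := cs.isLeftDescent_iff.1 hrw
      unfold CoxeterSystem.IsReduced
      rw [ew, ← a2, ← ez, a1]; simp
    · obtain ⟨v, hv, ev⟩ := three_step cs hrt h2 hrd htt
      have evw : cs.wordProd (r :: t :: v) = w := by
        rw [cs.wordProd_cons] at ev; exact mul_left_cancel ev
      have hrv := red_tail cs hv
      by_cases hrs : r = s
      · subst hrs
        exact ⟨v, hrv, evw⟩
      exfalso
      have hrw : cs.IsLeftDescent w r := by rw [← evw]; exact red_cons_desc cs hrv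
      obtain ⟨y, hy, ey⟩ := two_step cs (Ne.symm hrs) hs hrw
      have eyw : cs.wordProd (s :: y) = cs.simple r * w := by
        rw [← ey, cs.wordProd_cons r]; simp
      have hvw : cs.wordProd (t :: v) = cs.simple r * w := by
        rw [← evw, cs.wordProd_cons r]; simp
      exact hst2 (fc_desc_comm cs (fc_suffix cs hw hrw) hst
        (by rw [← eyw]; exact red_cons_desc cs (red_tail cs hy))
        (by rw [← hvw]; exact red_cons_desc cs (red_tail cs hrv)))

end Helpers

theorem stmt5 {B W : Type*} [Group W] {M : CoxeterMatrix B}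
    (cs : CoxeterSystem M W) (w : W) (hw : IsFC cs w)
    (s t : B) (hs : cs.IsLeftDescent w s) (hm : Big M s t)
    (ht : ¬ IsFC cs (cs.simple t * w)) :
    ∃ v : W, w = cs.simple s * cs.simple t * v ∧
      cs.length w = cs.length v + 2 := by
  obtain ⟨v, hv, ev⟩ := main_aux cs s t hm _ w rfl hw hs ht
  refine ⟨cs.wordProd v, ?_, ?_⟩
  · rw [← ev, cs.wordProd_cons, cs.wordProd_cons, mul_assoc]
  · rw [← ev, hv.eq, (red_tail cs (red_tail cs hv)).eq]; simp


end CoxFC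
end

section
/- Let W be the Coxeter group of affine type D̃_{n+2}. Every complete zigzag element is star irreducible. In particular, for w = s_0 s_1 (AB)^k A^h with A = s_2 s_3 ⋯ s_n s_{n+1} s_{n+2}, B = s_n s_{n-1} ⋯ s_2 s_1 s_0, k ≥ 0, h ∈ {0,1}, k+h > 0, the element w is fully commutative and admits no star reduction. -/
open CoxeterSystem

namespace CoxFC


open CoxeterSystem


variable {B : Type*} {W : Type*} [Group W] {M : CoxeterMatrix B}

/-- One orientation of the edges of the Coxeter graph of type D̃_{n+2}. -/
def DHalf (n a b : ℕ) : Prop :=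
  (a = 0 ∧ b = 2) ∨ (a = 1 ∧ b = 2) ∨ (2 ≤ a ∧ a ≤ n ∧ b = a + 1) ∨ (a = n ∧ b = n + 2)

/-- Adjacency (bond of order 3) in the Coxeter graph of type D̃_{n+2}:
`s_0, s_1` are joined to `s_2`, `s_2 — s_3 — ⋯ — s_n` is a path, and
`s_{n+1}, s_{n+2}` are joined to `s_n`. -/
def DAdj (n a b : ℕ) : Prop := DHalf n a b ∨ DHalf n b a

instance (n a b : ℕ) : Decidable (DAdj n a b) := by unfold DAdj DHalf; infer_instance

lemma dAdj_symm (n a b : ℕ) : DAdj n a b ↔ DAdj n b a := or_comm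

lemma dHalf_ne (n a b : ℕ) (h : DHalf n a b) : a ≠ b := by unfold DHalf at h; omega

lemma dAdj_ne (n a b : ℕ) (h : DAdj n a b) : a ≠ b := by
  rcases h with h | h
  · exact dHalf_ne n a b h
  · exact (dHalf_ne n b a h).symm

/-- The Coxeter matrix of affine type D̃_{n+2}, with vertices `s_0, …, s_{n+2}`. -/
def DMatrix (n : ℕ) : CoxeterMatrix (Fin (n+3)) where
  M := Matrix.of fun i j : Fin (n+3) ↦
    if DAdj n i j then 3 else if i = j then 1 else 2
  isSymm := by
    apply Matrix.IsSymm.ext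
    intro i j
    simp only [Matrix.of_apply]
    by_cases h : DAdj n (i : ℕ) (j : ℕ)
    · rw [if_pos h, if_pos ((dAdj_symm n (i : ℕ) (j : ℕ)).mp h)]
    · rw [if_neg h, if_neg (fun hh => h ((dAdj_symm n (j : ℕ) (i : ℕ)).mp hh))]
      by_cases h2 : (j : Fin (n+3)) = i
      · simp [h2]
      · rw [if_neg h2, if_neg (fun hh => h2 hh.symm)]
  diagonal i := by
    have : ¬ DAdj n (i : ℕ) (i : ℕ) := fun h => dAdj_ne n i i h rfl
    simp [this]
  off_diagonal i j h := by
    have h2 : (i : Fin (n+3)) ≠ j := h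
    by_cases hA : DAdj n (i : ℕ) (j : ℕ) <;> simp [Matrix.of_apply, hA, h2]

/-- The generator `s_k` of type D̃_{n+2}, for `k ≤ n+2`. -/
def dv (n k : ℕ) : Fin (n+3) := ⟨k % (n+3), Nat.mod_lt _ (Nat.succ_pos _)⟩



variable {n : ℕ} {W : Type*} [Group W]

/-- The generators `{s_3, s_5, …, s_{n-1}}` (odd indices from 3 to n-1). -/
def OddCore (n : ℕ) : Set (Fin (n+3)) :=
  {a | 3 ≤ (a : ℕ) ∧ (a : ℕ) ≤ n - 1 ∧ (a : ℕ) % 2 = 1}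

/-- The generators `{s_2, s_4, …, s_n}` (even indices from 2 to n). -/
def EvenCore (n : ℕ) : Set (Fin (n+3)) :=
  {a | 2 ≤ (a : ℕ) ∧ (a : ℕ) ≤ n ∧ (a : ℕ) % 2 = 0}

/-- A candy element of type D̃_{n+2} (for n even): an FC element whose
Cartier–Foata normal form `u_0 ⋯ u_m` has `m ≥ 2` even,
`supp(u_{2i}) = {s_3, s_5, …, s_{n-1}} ∪ {x_i, y_i}` with `x_i ∈ {s_0, s_1}`,
`y_i ∈ {s_{n+1}, s_{n+2}}`, `x_i ≠ x_{i+1}`, `y_i ≠ y_{i+1}`, and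
`supp(u_{2i+1}) = {s_2, s_4, …, s_n}`. -/
def IsCandy (cs : CoxeterSystem (DMatrix n) W) (w : W) : Prop :=
  ∃ (us : List (List (Fin (n+3)))) (m : ℕ) (x y : ℕ → Fin (n+3)),
    IsCFNF cs w us ∧ us.length = m + 1 ∧ 2 ≤ m ∧ m % 2 = 0 ∧
    (∀ i : ℕ, 2*i ≤ m →
      ((x i : ℕ) = 0 ∨ (x i : ℕ) = 1) ∧ ((y i : ℕ) = n+1 ∨ (y i : ℕ) = n+2) ∧
      {a | a ∈ us.getD (2*i) []} = OddCore n ∪ {x i, y i}) ∧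
    (∀ i : ℕ, 2*(i+1) ≤ m → x i ≠ x (i+1) ∧ y i ≠ y (i+1)) ∧
    (∀ i : ℕ, 2*i+1 ≤ m → {a | a ∈ us.getD (2*i+1) []} = EvenCore n)

/-- The word `A = s_2 s_3 ⋯ s_n s_{n+1} s_{n+2}`. -/
def AWord (n : ℕ) : List (Fin (n+3)) := (List.range' 2 (n+1)).map (dv n)

/-- The word `B = s_n s_{n-1} ⋯ s_2 s_1 s_0`. -/
def BWord (n : ℕ) : List (Fin (n+3)) := ((List.range (n+1)).reverse).map (dv n)

/-- The word `s_0 s_1 (AB)^k A^h`. -/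
def ZigWord1 (n k h : ℕ) : List (Fin (n+3)) :=
  [dv n 0, dv n 1] ++ (List.replicate k (AWord n ++ BWord n)).flatten ++
    (List.replicate h (AWord n)).flatten

/-- The word `s_{n+2} s_{n+1} (BA)^k B^h`. -/
def ZigWord2 (n k h : ℕ) : List (Fin (n+3)) :=
  [dv n (n+2), dv n (n+1)] ++ (List.replicate k (BWord n ++ AWord n)).flatten ++
    (List.replicate h (BWord n)).flatten

/-- A complete zigzag: an element admitting a reduced expression
`s_0 s_1 (AB)^k A^h` or `s_{n+2} s_{n+1} (BA)^k B^h`, `k ≥ 0`, `h ∈ {0,1}`, `k+h > 0`. -/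
def IsCompleteZigzag (cs : CoxeterSystem (DMatrix n) W) (w : W) : Prop :=
  ∃ k h : ℕ, h ≤ 1 ∧ 0 < k + h ∧
    ((cs.IsReduced (ZigWord1 n k h) ∧ cs.wordProd (ZigWord1 n k h) = w) ∨
     (cs.IsReduced (ZigWord2 n k h) ∧ cs.wordProd (ZigWord2 n k h) = w))

/-- A weak zigzag: a factor of a complete zigzag that is not a product of
pairwise commuting generators. -/
def IsWeakZigzag (cs : CoxeterSystem (DMatrix n) W) (w : W) : Prop :=
  (∃ z x y : W, IsCompleteZigzag cs z ∧ z = x * w * y ∧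
      cs.length z = cs.length x + cs.length w + cs.length y) ∧ ¬ IsCC cs w

/-- The number of occurrences of the (contiguous) factor `a b` in the word `l`. -/
def CountFactor {n : ℕ} (a b : Fin (n+3)) (l : List (Fin (n+3))) : ℕ :=
  (List.range (l.length - 1)).countP
    (fun i => (l.getD i a == a) && (l.getD (i+1) b == b))

/-- `f_•(w)`: the maximal number of occurrences of the factor `s_0 s_1` over all
reduced expressions of `w`. -/
noncomputable def fBullet (cs : CoxeterSystem (DMatrix n) W) (w : W) : ℕ :=
  sSup {c | ∃ l, cs.IsReduced l ∧ cs.wordProd l = w ∧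
    CountFactor (dv n 0) (dv n 1) l = c}

/-- `f_∘(w)`: the maximal number of occurrences of the factor `s_{n+1} s_{n+2}`
over all reduced expressions of `w`. -/
noncomputable def fCirc (cs : CoxeterSystem (DMatrix n) W) (w : W) : ℕ :=
  sSup {c | ∃ l, cs.IsReduced l ∧ cs.wordProd l = w ∧
    CountFactor (dv n (n+1)) (dv n (n+2)) l = c}


section General

variable {Bt : Type*} {G : Type*} [Group G] {N : CoxeterMatrix Bt}

/-- All off-diagonal entries are 2 or 3. -/
def Simply (N : CoxeterMatrix Bt) : Prop := ∀ i j : Bt, i ≠ j → N i j = 2 ∨ N i j = 3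

open Classical in
/-- The signed permutation action used for the exchange condition. -/
noncomputable def sgnAct (cs : CoxeterSystem N G) (i : Bt) : Function.End (G × ZMod 2) :=
  fun p => (cs.simple i * p.1 * cs.simple i, p.2 + if p.1 = cs.simple i then 1 else 0)

lemma conj_eq_iff {a t r : G} (ha : a * a = 1) : a * t * a = r ↔ t = a * r * a := by
  constructor
  · rintro rfl
    calc t = (a * a) * t * (a * a) := by rw [ha]; simp
      _ = _ := by group
  · rintro rfl
    calc a * (a * r * a) * a = (a * a) * r * (a * a) := by group
      _ = r := by rw [ha]; simp

lemma zmod2_aux (x y : ZMod 2) : x + y + y = x := by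
  rw [add_assoc, CharTwo.add_self_eq_zero, add_zero]

lemma sgnAct_liftable (hN : Simply N) (cs : CoxeterSystem N G) :
    N.IsLiftable (sgnAct cs) := by
  classical
  intro i j
  have ha := cs.simple_mul_simple_self i
  have hb := cs.simple_mul_simple_self j
  have hp := cs.simple_mul_simple_pow i j
  have ha' : ∀ x, cs.simple i * (cs.simple i * x) = x := fun x => by
    rw [← mul_assoc, ha, one_mul]
  have hb' : ∀ x, cs.simple j * (cs.simple j * x) = x := fun x => by
    rw [← mul_assoc, hb, one_mul]
  by_cases hij : i = j
  · subst hij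
    rw [N.diagonal, pow_one]
    funext ⟨t, e⟩
    change (_, _) = (t, e)
    simp only [sgnAct, conj_eq_iff ha]
    rw [Prod.mk.injEq]
    refine ⟨?_, ?_⟩
    · simp only [mul_assoc, ha, ha', mul_one]
    · simp only [ha, one_mul]
      exact zmod2_aux _ _
  · rcases hN i j hij with h | h
    · rw [h] at hp ⊢
      generalize hA : cs.simple i = a at *
      generalize hB : cs.simple j = b at *
      have hc : a * b = b * a := by
        have : a * b * (a * b) = 1 := by rw [← pow_two]; exact hp
        calc a * b = (a * b) * ((b * (a * a) * b)) := by rw [ha]; simp [hb]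
          _ = (a * b * b * a) * (a * b) := by group
          _ = (a * b * b * a) * (a * b) * ((a * b) * (a * b))⁻¹ := by rw [this]; simp
          _ = a * (b * b) * a * (a * b)⁻¹ := by group
          _ = (a * b)⁻¹ := by rw [hb]; simp [ha]
          _ = b * a := by
            rw [mul_inv_rev, inv_eq_of_mul_eq_one_right ha, inv_eq_of_mul_eq_one_right hb]
      have h1 : b * a * b = a := by rw [← hc, mul_assoc, hb, mul_one]
      have h2 : a * b * a = b := by rw [hc, mul_assoc, ha, mul_one]
      funext ⟨t, e⟩
      change ((sgnAct cs i * sgnAct cs j) ^ 2) (t, e) = (t, e)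
      rw [pow_two]
      change sgnAct cs i (sgnAct cs j (sgnAct cs i (sgnAct cs j (t, e)))) = (t, e)
      simp only [sgnAct, hA, hB, conj_eq_iff ha, conj_eq_iff hb, ha, hb, one_mul, h1, h2]
      rw [Prod.mk.injEq]
      refine ⟨?_, ?_⟩
      · calc _ = (a * b * (a * b)) * t * (b * a * (b * a)) := by group
          _ = ((a * b * a) * b) * t * ((b * a * b) * a) := by group
          _ = t := by rw [h1, h2, ha, hb]; simp
      · generalize (if t = a then (1 : ZMod 2) else 0) = x
        generalize (if t = b then (1 : ZMod 2) else 0) = y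
        revert e x y; decide
    · rw [h] at hp ⊢
      generalize hA : cs.simple i = a at *
      generalize hB : cs.simple j = b at *
      have hc : a * b * a = b * a * b := by
        have h6 : a * b * a * (b * a * b) = 1 := by
          rw [← hp]; simp only [pow_succ, pow_zero, one_mul]; group
        have := eq_inv_of_mul_eq_one_left h6
        rw [this]
        rw [mul_inv_rev, mul_inv_rev, inv_eq_of_mul_eq_one_right ha,
          inv_eq_of_mul_eq_one_right hb]
        group
      have h1 : b * (a * b * a) * b = a := by
        rw [hc]; simp only [mul_assoc, hb, hb', mul_one]
      have h2 : a * (b * a * b) * a = b := by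
        rw [← hc]; simp only [mul_assoc, ha, ha', mul_one]
      funext ⟨t, e⟩
      change ((sgnAct cs i * sgnAct cs j) ^ 3) (t, e) = (t, e)
      rw [pow_succ, pow_two]
      change sgnAct cs i (sgnAct cs j (sgnAct cs i (sgnAct cs j (sgnAct cs i (sgnAct cs j (t, e)))))) = (t, e)
      simp only [sgnAct, hA, hB, conj_eq_iff ha, conj_eq_iff hb, ha, hb, one_mul, h1, h2]
      rw [Prod.mk.injEq]
      refine ⟨?_, ?_⟩
      · calc _ = (a * (b * a * b) * a * b) * t * (b * (a * (b * a * b) * a)) := by group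
          _ = t := by rw [h2, hb]; simp
      · generalize (if t = a then (1 : ZMod 2) else 0) = x
        generalize (if t = b then (1 : ZMod 2) else 0) = y
        generalize (if t = b * a * b then (1 : ZMod 2) else 0) = z
        revert e x y z; decide

open Classical in
lemma sgnAct_word (hN : Simply N) (cs : CoxeterSystem N G) (l : List Bt) (t : G) (e : ZMod 2) :
    cs.lift ⟨sgnAct cs, sgnAct_liftable hN cs⟩ (cs.wordProd l) (t, e)
      = (cs.wordProd l * t * (cs.wordProd l)⁻¹, e + ((cs.rightInvSeq l).count t : ZMod 2)) := by
  induction l with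
  | nil => simp; rfl
  | cons i l ih =>
    rw [wordProd_cons, map_mul]
    change cs.lift ⟨sgnAct cs, sgnAct_liftable hN cs⟩ (cs.simple i)
      (cs.lift ⟨sgnAct cs, sgnAct_liftable hN cs⟩ (cs.wordProd l) (t, e)) = _
    rw [ih, lift_apply_simple]
    simp only [sgnAct, rightInvSeq, List.count_cons, beq_iff_eq]
    rw [Prod.mk.injEq]
    refine ⟨by simp [mul_assoc], ?_⟩
    have : (cs.wordProd l * t * (cs.wordProd l)⁻¹ = cs.simple i) ↔
      ((cs.wordProd l)⁻¹ * cs.simple i * cs.wordProd l = t) := by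
      constructor
      · intro h; rw [← h]; group
      · intro h; rw [← h]; group
    simp only [this]
    push_cast
    ring

lemma right_exchange (hN : Simply N) (cs : CoxeterSystem N G) (l : List Bt) (i : Bt)
    (hd : cs.IsRightDescent (cs.wordProd l) i) : cs.simple i ∈ cs.rightInvSeq l := by
  classical
  obtain ⟨u, hu, hw⟩ := cs.exists_isReduced (cs.wordProd l * cs.simple i)
  have hl : cs.wordProd (u.concat i) = cs.wordProd l := by
    rw [wordProd_concat, ← hw]; simp
  have hred : cs.IsReduced (u.concat i) := by
    have h1 := (cs.isRightDescent_iff).mp hd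
    rw [hw, hu.eq] at h1
    unfold CoxeterSystem.IsReduced
    rw [hl, ← h1]; simp
  have hnd := hred.nodup_rightInvSeq
  have h1 := sgnAct_word hN cs l (cs.simple i) 0
  have h2 := sgnAct_word hN cs (u.concat i) (cs.simple i) 0
  rw [hl] at h2
  rw [h1] at h2
  have h3 := congrArg Prod.snd h2
  have hmem : cs.simple i ∈ cs.rightInvSeq (u.concat i) := by
    rw [rightInvSeq_concat]; simp
  rw [List.count_eq_one_of_mem hnd hmem] at h3
  by_contra hc
  rw [List.count_eq_zero_of_not_mem hc] at h3
  simp at h3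

lemma left_exchange (hN : Simply N) (cs : CoxeterSystem N G) (l : List Bt) (i : Bt)
    (hd : cs.IsLeftDescent (cs.wordProd l) i) :
    ∃ j, j < l.length ∧ cs.simple i * cs.wordProd l = cs.wordProd (l.eraseIdx j) := by
  have h1 : cs.IsRightDescent (cs.wordProd l.reverse) i := by
    rw [wordProd_reverse, isRightDescent_inv_iff]; exact hd
  have h2 := right_exchange hN cs _ _ h1
  rw [rightInvSeq_reverse, List.mem_reverse] at h2
  obtain ⟨j, hj, hj'⟩ := List.mem_iff_getElem.mp h2
  refine ⟨j, by simpa using hj, ?_⟩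
  rw [← cs.getD_leftInvSeq_mul_wordProd, List.getD_eq_getElem _ _ hj, hj']

open Classical in
/-- The numbers game representation. -/
noncomputable def numAct (N : CoxeterMatrix Bt) (i : Bt) : Function.End (Bt → ℤ) :=
  fun v k => if k = i then - v i else if N k i = 3 then v k + v i else v k

lemma numAct_liftable (hN : Simply N) : N.IsLiftable (numAct N) := by
  classical
  intro i j
  by_cases hij : i = j
  · subst hij
    rw [N.diagonal, pow_one]
    funext v k
    change numAct N i (numAct N i v) k = v k
    by_cases h1 : k = i
    · simp [numAct, h1]
    · by_cases h2 : N k i = 3 <;> simp [numAct, h1, h2]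
  · have hji : j ≠ i := fun h => hij h.symm
    rcases hN i j hij with h | h
    · have h' : N j i = 2 := by rw [N.symmetric]; exact h
      rw [h, pow_two]
      funext v k
      change numAct N i (numAct N j (numAct N i (numAct N j v))) k = v k
      by_cases hki : k = i
      · subst hki; simp [numAct, h, h', hij, hji]
      by_cases hkj : k = j
      · subst hkj; simp [numAct, h, h', hij, hji]
      by_cases h1 : N k i = 3 <;> by_cases h2 : N k j = 3 <;>
        simp [numAct, h, h', hij, hji, h1, h2, hki, hkj] <;> ring
    · have h' : N j i = 3 := by rw [N.symmetric]; exact h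
      rw [h, pow_succ, pow_two]
      funext v k
      change numAct N i (numAct N j (numAct N i (numAct N j (numAct N i (numAct N j v))))) k = v k
      by_cases hki : k = i
      · subst hki; simp [numAct, h, h', hij, hji]
      by_cases hkj : k = j
      · subst hkj; simp [numAct, h, h', hij, hji]
      by_cases h1 : N k i = 3 <;> by_cases h2 : N k j = 3 <;>
        simp [numAct, h, h', hij, hji, h1, h2, hki, hkj] <;> ring

lemma simple_inj_s15 (hN : Simply N) (cs : CoxeterSystem N G) {i j : Bt}
    (h : cs.simple i = cs.simple j) : i = j := by
  classical
  by_contra hij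
  have h1 := congrArg (cs.lift ⟨numAct N, numAct_liftable hN⟩) h
  rw [lift_apply_simple, lift_apply_simple] at h1
  have h2 := congrFun (congrFun h1 (fun _ => 1)) i
  simp only [numAct, if_true, hij, if_false] at h2
  split_ifs at h2 <;> omega

lemma CommStep.symm' {l l' : List Bt} (h : CommStep N l l') : CommStep N l' l := by
  obtain ⟨x, y, a, b, hab, rfl, rfl⟩ := h
  exact ⟨x, y, b, a, by rw [N.symmetric]; exact hab, rfl, rfl⟩

lemma CommEquiv.symm' {l l' : List Bt} (h : CommEquiv N l l') : CommEquiv N l' l := by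
  induction h with
  | refl => exact Relation.ReflTransGen.refl
  | tail _ h2 ih => exact Relation.ReflTransGen.head h2.symm' ih

lemma CommEquiv.trans' {l l' l'' : List Bt} (h : CommEquiv N l l') (h' : CommEquiv N l' l'') :
    CommEquiv N l l'' := Relation.ReflTransGen.trans h h'

lemma CommEquiv.cons {l l' : List Bt} (a : Bt) (h : CommEquiv N l l') :
    CommEquiv N (a :: l) (a :: l') := by
  induction h with
  | refl => exact Relation.ReflTransGen.refl
  | tail _ h2 ih =>
    refine Relation.ReflTransGen.tail ih ?_
    obtain ⟨x, y, b, c, hab, rfl, rfl⟩ := h2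
    exact ⟨a :: x, y, b, c, hab, rfl, rfl⟩

lemma CommEquiv.swap {a b : Bt} (l : List Bt) (h : N a b = 2) :
    CommEquiv N (a :: b :: l) (b :: a :: l) :=
  Relation.ReflTransGen.single ⟨[], l, a, b, h, rfl, rfl⟩

/-- No word in the commutation class has a factor `ss` or `sts` with `m(s,t) = 3`. -/
def Good (N : CoxeterMatrix Bt) (l : List Bt) : Prop :=
  ∀ l', CommEquiv N l l' → ∀ x y s, l' ≠ x ++ s :: s :: y ∧
    ∀ t, N s t = 3 → l' ≠ x ++ s :: t :: s :: y

lemma Good.equiv {l l' : List Bt} (h : Good N l) (h' : CommEquiv N l l') : Good N l' :=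
  fun _ h2 => h _ (h'.trans' h2)

lemma Good.tail {a : Bt} {l : List Bt} (h : Good N (a :: l)) : Good N l := by
  intro l' h' x y s
  refine ⟨fun he => (h _ (h'.cons a) (a :: x) y s).1 (by rw [he]; rfl), fun t ht he =>
    (h _ (h'.cons a) (a :: x) y s).2 t ht (by rw [he]; rfl)⟩

lemma IsReduced.tail' (cs : CoxeterSystem N G) {a : Bt} {l : List Bt}
    (h : cs.IsReduced (a :: l)) : cs.IsReduced l := h.drop 1

lemma descent_of_cons (cs : CoxeterSystem N G) {a : Bt} {l : List Bt}
    (h : cs.IsReduced (a :: l)) : cs.IsLeftDescent (cs.wordProd (a :: l)) a := by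
  unfold CoxeterSystem.IsLeftDescent
  rw [h.eq, wordProd_cons, simple_mul_simple_cancel_left]
  have := cs.length_wordProd_le l
  simp; omega

lemma reduced_of_len (cs : CoxeterSystem N G) {l l' : List Bt} (h : cs.IsReduced l)
    (hp : cs.wordProd l' = cs.wordProd l) (hl : l'.length ≤ l.length) : cs.IsReduced l' := by
  unfold CoxeterSystem.IsReduced
  have := cs.length_wordProd_le l'
  have h2 := h.eq
  rw [hp] at *
  omega

/-- Exchange when the word starts with a different letter. -/
lemma exchange_ne (hN : Simply N) (cs : CoxeterSystem N G) {s t : Bt} {u : List Bt} (hst : s ≠ t)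
    (hr : cs.IsReduced (s :: u)) (hd : cs.IsLeftDescent (cs.wordProd (s :: u)) t) :
    ∃ j, j < u.length ∧ cs.wordProd (s :: u) = cs.wordProd (t :: s :: u.eraseIdx j) ∧
      cs.IsReduced (t :: s :: u.eraseIdx j) := by
  obtain ⟨j, hj, he⟩ := left_exchange hN cs _ _ hd
  rcases j with _ | j
  · exfalso
    simp only [List.eraseIdx_cons_zero, wordProd_cons] at he
    rw [← mul_assoc] at he
    have h1 := mul_eq_right.mp he
    have h2 : cs.simple t = cs.simple s := by
      rw [← cs.inv_simple s]; exact eq_inv_of_mul_eq_one_left h1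
    exact hst (simple_inj_s15 hN cs h2).symm
  · have hj' : j < u.length := by simpa using hj
    have hp : cs.wordProd (s :: u) = cs.wordProd (t :: s :: u.eraseIdx j) := by
      rw [wordProd_cons cs t]
      rw [List.eraseIdx_cons_succ] at he
      rw [← he, simple_mul_simple_cancel_left]
    refine ⟨j, hj', hp, reduced_of_len cs hr hp.symm ?_⟩
    have := List.length_eraseIdx_add_one hj'
    simp; omega

lemma good_unique (hN : Simply N) (cs : CoxeterSystem N G) : ∀ (m : ℕ) (l l' : List Bt),
    l.length = m → Good N l → cs.IsReduced l → cs.IsReduced l' →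
    cs.wordProd l = cs.wordProd l' → CommEquiv N l l' := by
  intro m
  induction m with
  | zero =>
    intro l l' hl hg hr hr' hp
    have h1 := hr.eq
    have h2 := hr'.eq
    rw [hp, h2, hl] at h1
    rw [List.length_eq_zero_iff.mp hl, List.length_eq_zero_iff.mp h1]
    exact Relation.ReflTransGen.refl
  | succ m ih =>
    intro l l' hl hg hr hr' hp
    have hll : l'.length = l.length := by rw [← hr.eq, ← hr'.eq, hp]
    obtain ⟨s, u, rfl⟩ : ∃ s u, l = s :: u := by
      cases l with
      | nil => simp at hl
      | cons s u => exact ⟨s, u, rfl⟩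
    obtain ⟨t, v, rfl⟩ : ∃ s u, l' = s :: u := by
      cases l' with
      | nil => simp at hll
      | cons s u => exact ⟨s, u, rfl⟩
    have hu : u.length = m := by simpa using hl
    have hru := IsReduced.tail' cs hr
    have hrv := IsReduced.tail' cs hr'
    by_cases hst : s = t
    · subst hst
      refine CommEquiv.cons s (ih u v hu hg.tail hru hrv ?_)
      simpa [wordProd_cons] using hp
    · have hd : cs.IsLeftDescent (cs.wordProd (s :: u)) t := by
        rw [hp]; exact descent_of_cons cs hr'
      obtain ⟨j, hj, hp2, hr2⟩ := exchange_ne hN cs hst hr hd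
      have hlen := List.length_eraseIdx_add_one hj
      generalize u.eraseIdx j = u' at *
      rcases hN s t hst with hm | hm
      · have hsw : cs.wordProd (s :: t :: u') = cs.wordProd (t :: s :: u') := by
          have h2 := cs.simple_mul_simple_pow s t
          rw [hm, pow_two] at h2
          have h3 := eq_inv_of_mul_eq_one_left h2
          rw [mul_inv_rev, inv_simple, inv_simple] at h3
          simp only [wordProd_cons, ← mul_assoc]
          rw [h3]
        have hr3 : cs.IsReduced (s :: t :: u') := reduced_of_len cs hr2 hsw (by simp)
        have e1 : CommEquiv N u (t :: u') := by
          refine ih _ _ hu hg.tail hru (IsReduced.tail' cs hr3) ?_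
          have h4 := hp2.trans hsw.symm
          rw [wordProd_cons, wordProd_cons cs s] at h4
          exact mul_left_cancel h4
        have e2 : CommEquiv N (s :: u) (t :: s :: u') := (e1.cons s).trans' (CommEquiv.swap _ hm)
        have e3 : CommEquiv N (s :: u') v := by
          refine ih _ _ (by simp; omega) (hg.equiv e2).tail (IsReduced.tail' cs hr2) hrv ?_
          have h4 := hp2.symm.trans hp
          rw [wordProd_cons, wordProd_cons cs t] at h4
          exact mul_left_cancel h4
        exact e2.trans' (e3.cons t)
      · exfalso
        have hd2 : cs.IsLeftDescent (cs.wordProd (t :: s :: u')) s := by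
          rw [← hp2]; exact descent_of_cons cs hr
        obtain ⟨i, hi, hp3, hr3⟩ := exchange_ne hN cs (Ne.symm hst) hr2 hd2
        rcases i with _ | i
        · simp only [List.eraseIdx_cons_zero] at hp3
          simp only [wordProd_cons, ← mul_assoc] at hp3
          have h5 := mul_right_cancel hp3
          have h2 := cs.simple_mul_simple_pow s t
          rw [hm, pow_succ, pow_two] at h2
          have h6 : cs.simple s * cs.simple t * (cs.simple s * cs.simple t) = 1 := by
            nth_rewrite 1 [← h5]; simp [mul_assoc]
          rw [h6, one_mul] at h2
          have h7 := eq_inv_of_mul_eq_one_left h2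
          rw [inv_simple] at h7
          exact hst (simple_inj_s15 hN cs h7)
        · rw [List.eraseIdx_cons_succ] at hp3 hr3
          generalize u'.eraseIdx i = u'' at *
          have e1 : CommEquiv N u (t :: s :: u'') := by
            refine ih _ _ hu hg.tail hru (IsReduced.tail' cs hr3) ?_
            have h4 := hp2.trans hp3
            rw [wordProd_cons, wordProd_cons cs s] at h4
            exact mul_left_cancel h4
          exact (hg _ (e1.cons s) [] u'' s).2 t hm rfl

lemma good_reduced (hN : Simply N) (cs : CoxeterSystem N G) (l : List Bt) (hg : Good N l) :
    cs.IsReduced l := by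
  induction l with
  | nil => simp [CoxeterSystem.IsReduced]
  | cons s u ih =>
    have hu := ih hg.tail
    by_contra hr
    have hd : cs.IsLeftDescent (cs.wordProd u) s := by
      by_contra hc
      rw [cs.not_isLeftDescent_iff] at hc
      apply hr
      unfold CoxeterSystem.IsReduced
      rw [wordProd_cons, hc, hu.eq]; simp
    obtain ⟨j, hj, he⟩ := left_exchange hN cs _ _ hd
    have hlen := List.length_eraseIdx_add_one hj
    have hp : cs.wordProd (s :: u.eraseIdx j) = cs.wordProd u := by
      rw [wordProd_cons, ← he, simple_mul_simple_cancel_left]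
    have hr2 := reduced_of_len cs hu hp (by simp; omega)
    have e := good_unique hN cs _ _ _ rfl hg.tail hu hr2 hp.symm
    exact (hg _ (e.cons s) [] _ s).1 rfl

lemma good_fc (hN : Simply N) (cs : CoxeterSystem N G) (l : List Bt) (hg : Good N l) :
    IsFC cs (cs.wordProd l) := by
  intro a b ha hb hpa hpb
  have hl := good_reduced hN cs l hg
  exact (good_unique hN cs _ _ _ rfl hg hl ha hpa.symm).symm'.trans'
    (good_unique hN cs _ _ _ rfl hg hl hb hpb.symm)

lemma word_of_descent (cs : CoxeterSystem N G) {w : G} {s : Bt} (hd : cs.IsLeftDescent w s)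
    {u : List Bt} (hu : cs.IsReduced u) (hp : cs.wordProd u = cs.simple s * w) :
    cs.IsReduced (s :: u) ∧ cs.wordProd (s :: u) = w := by
  have h1 : cs.wordProd (s :: u) = w := by
    rw [wordProd_cons, hp, simple_mul_simple_cancel_left]
  refine ⟨?_, h1⟩
  unfold CoxeterSystem.IsReduced
  rw [h1, ← cs.isLeftDescent_iff.mp hd, ← hp, hu.eq]; simp

lemma good_left_irred (hN : Simply N) (cs : CoxeterSystem N G) (l : List Bt) (hg : Good N l)
    (hs : ∀ l', CommEquiv N l l' → ∀ s t y, N s t = 3 → l' ≠ s :: t :: y) (s t : Bt) :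
    ¬ IsLeftStarReducible cs s t (cs.wordProd l) := by
  rintro ⟨hb, h1, h2⟩
  obtain ⟨u, hu, hp⟩ := cs.exists_isReduced (cs.simple t * (cs.simple s * cs.wordProd l))
  obtain ⟨a1, a2⟩ := word_of_descent cs h2 hu hp.symm
  obtain ⟨b1, b2⟩ := word_of_descent cs h1 a1 a2
  have e := good_unique hN cs _ _ _ rfl hg (good_reduced hN cs l hg) b1 b2.symm
  have hne : s ≠ t := by
    rintro rfl
    unfold Big at hb
    rw [N.diagonal] at hb
    omega
  have h3 : N s t = 3 := by
    rcases hN s t hne with h | h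
    · unfold Big at hb; omega
    · exact h
  exact hs _ e s t u h3 rfl

open Classical in
/-- One reading step of the acceptor. -/
noncomputable def stp (N : CoxeterMatrix Bt) (c : Bt → ℕ) (a : Bt) : Bt → ℕ :=
  fun j => if j = a then 0 else if N j a = 3 then c j + 1 else c j

/-- Acceptance: each letter `a` is read only when its counter is at least `2`. -/
def Acc (N : CoxeterMatrix Bt) : (Bt → ℕ) → List Bt → Prop
  | _, [] => True
  | c, a :: l => 2 ≤ c a ∧ Acc N (stp N c a) l

lemma acc_append (c : Bt → ℕ) (x y : List Bt) :
    Acc N c (x ++ y) ↔ Acc N c x ∧ Acc N (x.foldl (stp N) c) y := by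
  induction x generalizing c with
  | nil => simp [Acc]
  | cons a x ih => simp [Acc, ih, and_assoc]

lemma acc_comm {c : Bt → ℕ} {l l' : List Bt} (h : CommStep N l l') (ha : Acc N c l) :
    Acc N c l' := by
  classical
  obtain ⟨x, y, a, b, hab, rfl, rfl⟩ := h
  rw [acc_append] at ha ⊢
  refine ⟨ha.1, ?_⟩
  replace ha := ha.2
  generalize x.foldl (stp N) c = c at *
  have hba : N b a = 2 := by rw [N.symmetric]; exact hab
  have hne : a ≠ b := by rintro rfl; rw [N.diagonal] at hab; omega
  obtain ⟨h1, h2, h3⟩ := ha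
  refine ⟨?_, ?_, ?_⟩
  · simpa [stp, hba, hne.symm] using h2
  · simpa [stp, hab, hne] using h1
  · convert h3 using 1
    funext j
    by_cases hja : j = a
    · subst hja; simp [stp, hab, hne]
    by_cases hjb : j = b
    · subst hjb; simp [stp, hba, hne]
    by_cases p : N j a = 3 <;> by_cases q : N j b = 3 <;> simp [stp, hja, hjb, p, q]

lemma acc_equiv {c : Bt → ℕ} {l l' : List Bt} (h : CommEquiv N l l') (ha : Acc N c l) :
    Acc N c l' := by
  induction h with
  | refl => exact ha
  | tail _ h2 ih => exact acc_comm h2 ih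

lemma acc_good {c : Bt → ℕ} {l : List Bt} (ha : Acc N c l) : Good N l := by
  intro l' h x y s
  have h1 := acc_equiv h ha
  refine ⟨?_, ?_⟩
  · rintro rfl
    rw [acc_append] at h1
    have := h1.2.2.1
    simp [stp] at this
  · rintro t ht rfl
    rw [acc_append] at h1
    have := h1.2.2.2.1
    have hne : s ≠ t := by rintro rfl; rw [N.diagonal] at ht; omega
    simp [stp, ht, hne] at this

lemma acc_left_irred (hN : Simply N) (cs : CoxeterSystem N G) (c : Bt → ℕ) (l : List Bt)
    (ha : Acc N c l) (hc : ∀ s t, N s t = 3 → 2 ≤ c s → c t = 0) (s t : Bt) :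
    ¬ IsLeftStarReducible cs s t (cs.wordProd l) := by
  refine good_left_irred hN cs l (acc_good ha) ?_ s t
  rintro l' h s t y hst rfl
  obtain ⟨h1, h2, -⟩ := acc_equiv h ha
  have hts : N t s = 3 := by rw [N.symmetric]; exact hst
  have hne : t ≠ s := by rintro rfl; rw [N.diagonal] at hst; omega
  simp [stp, hne, hts, hc s t hst h1] at h2

lemma star_irred_of_acc (hN : Simply N) (cs : CoxeterSystem N G) (c d : Bt → ℕ) (l : List Bt)
    (ha : Acc N c l) (hc : ∀ s t, N s t = 3 → 2 ≤ c s → c t = 0)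
    (hb : Acc N d l.reverse) (hd : ∀ s t, N s t = 3 → 2 ≤ d s → d t = 0) :
    StarIrreducible cs (cs.wordProd l) := by
  intro s t
  refine ⟨acc_left_irred hN cs c l ha hc s t, ?_⟩
  rintro ⟨h1, h2, h3⟩
  refine acc_left_irred hN cs d _ hb hd s t ⟨h1, ?_, ?_⟩
  · rw [wordProd_reverse, isLeftDescent_inv_iff]; exact h2
  · rw [wordProd_reverse, ← isRightDescent_inv_iff]
    simpa using h3

end General

section Zig

lemma dM_apply (n : ℕ) (i j : Fin (n+3)) : (DMatrix n) i j =
    if DAdj n i j then 3 else if i = j then 1 else 2 := rfl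

lemma dM_three (n : ℕ) (i j : Fin (n+3)) : (DMatrix n) i j = 3 ↔ DAdj n i j := by
  rw [dM_apply]; split_ifs <;> simp_all

lemma dM_simply (n : ℕ) : Simply (DMatrix n) := by
  intro i j hij
  rw [dM_apply]; split_ifs <;> simp

lemma dv_val (n k : ℕ) (hk : k < n + 3) : ((dv n k : Fin (n+3)) : ℕ) = k := Nat.mod_eq_of_lt hk

/-- The acceptor step, read off on values. -/
lemma stp_val (n k : ℕ) (hk : k < n + 3) (c : Fin (n+3) → ℕ) (j : Fin (n+3)) :
    stp (DMatrix n) c (dv n k) j =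
      if (j : ℕ) = k then 0 else if DAdj n j k then c j + 1 else c j := by
  unfold stp
  simp only [dM_three, Fin.ext_iff, dv_val n k hk]

lemma stp_cases (n k : ℕ) (hk : k < n + 3) (c : Fin (n+3) → ℕ) (j : Fin (n+3)) :
    ((j : ℕ) = k ∧ stp (DMatrix n) c (dv n k) j = 0) ∨
    ((j : ℕ) ≠ k ∧ (DHalf n j k ∨ DHalf n k j) ∧ stp (DMatrix n) c (dv n k) j = c j + 1) ∨
    ((j : ℕ) ≠ k ∧ ¬ (DHalf n j k ∨ DHalf n k j) ∧ stp (DMatrix n) c (dv n k) j = c j) := by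
  rw [stp_val n k hk]
  by_cases h1 : (j : ℕ) = k
  · simp [h1]
  · by_cases h2 : DAdj n j k
    · exact Or.inr (Or.inl ⟨h1, h2, by rw [if_neg h1, if_pos h2]⟩)
    · exact Or.inr (Or.inr ⟨h1, h2, by rw [if_neg h1, if_neg h2]⟩)

/-- Hoare triple for the acceptor. -/
def Tr (n : ℕ) (P : (Fin (n+3) → ℕ) → Prop) (l : List (Fin (n+3)))
    (Q : (Fin (n+3) → ℕ) → Prop) : Prop :=
  ∀ c, P c → Acc (DMatrix n) c l ∧ Q (l.foldl (stp (DMatrix n)) c)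

variable {n : ℕ} {P Q R : (Fin (n+3) → ℕ) → Prop}

lemma Tr.append {x y : List (Fin (n+3))} (h1 : Tr n P x Q) (h2 : Tr n Q y R) :
    Tr n P (x ++ y) R := by
  intro c hc
  rw [acc_append, List.foldl_append]
  exact ⟨⟨(h1 c hc).1, (h2 _ (h1 c hc).2).1⟩, (h2 _ (h1 c hc).2).2⟩

lemma Tr.nil : Tr n P [] P := fun _ hc => ⟨trivial, hc⟩

lemma Tr.rep {x : List (Fin (n+3))} (h : Tr n P x P) (k : ℕ) :
    Tr n P (List.replicate k x).flatten P := by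
  induction k with
  | zero => exact Tr.nil
  | succ k ih => rw [List.replicate_succ, List.flatten_cons]; exact h.append ih

lemma Tr.single {k : ℕ} (h : ∀ c, P c → 2 ≤ c (dv n k) ∧ Q (stp (DMatrix n) c (dv n k))) :
    Tr n P [dv n k] Q := fun c hc => ⟨⟨(h c hc).1, trivial⟩, (h c hc).2⟩

lemma Tr.weaken {x : List (Fin (n+3))} (h : Tr n P x Q) (hP : ∀ c, R c → P c) : Tr n R x Q :=
  fun c hc => h c (hP c hc)

/-- Before reading `s_2 ⋯ s_n`. -/
def SU (n : ℕ) (c : Fin (n+3) → ℕ) : Prop :=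
  ∀ j : Fin (n+3), ((j : ℕ) = 2 → 2 ≤ c j) ∧ (3 ≤ (j : ℕ) → 1 ≤ c j)

/-- After reading `s_2 ⋯ s_n`. -/
def EU (n : ℕ) (c : Fin (n+3) → ℕ) : Prop :=
  ∀ j : Fin (n+3), ((j : ℕ) < n → 1 ≤ c j) ∧ (n + 1 ≤ (j : ℕ) → 2 ≤ c j)

/-- Before reading `s_n ⋯ s_2`. -/
def SD (n : ℕ) (c : Fin (n+3) → ℕ) : Prop :=
  ∀ j : Fin (n+3), ((j : ℕ) = n → 2 ≤ c j) ∧ ((j : ℕ) < n → 1 ≤ c j)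

/-- After reading `s_n ⋯ s_2`. -/
def ED (n : ℕ) (c : Fin (n+3) → ℕ) : Prop :=
  ∀ j : Fin (n+3), ((j : ℕ) < 2 → 2 ≤ c j) ∧ (3 ≤ (j : ℕ) → 1 ≤ c j)

/-- Just before reading `s_m` on the way up. -/
def IU (n m : ℕ) (c : Fin (n+3) → ℕ) : Prop :=
  ∀ j : Fin (n+3), ((j : ℕ) = m → 2 ≤ c j) ∧ (m < (j : ℕ) → 1 ≤ c j) ∧
    (3 ≤ m → (j : ℕ) + 1 < m → 1 ≤ c j)

/-- Just before reading `s_m` on the way down. -/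
def ID (n m : ℕ) (c : Fin (n+3) → ℕ) : Prop :=
  ∀ j : Fin (n+3), ((j : ℕ) = m → 2 ≤ c j) ∧ ((j : ℕ) < m → 1 ≤ c j) ∧
    (m < n → m + 1 < (j : ℕ) → 1 ≤ c j)

lemma tr_up_step (m : ℕ) (hm : 2 ≤ m) (hmn : m < n) : Tr n (IU n m) [dv n m] (IU n (m+1)) := by
  apply Tr.single
  intro c hc
  refine ⟨(hc _).1 (dv_val n m (by omega)), fun j => ?_⟩
  have h1 := stp_cases n m (by omega) c j
  generalize stp (DMatrix n) c (dv n m) j = v at *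
  have := hc j
  have := j.2
  unfold DHalf at h1
  omega

lemma tr_up_last (hn : 2 ≤ n) : Tr n (IU n n) [dv n n] (EU n) := by
  apply Tr.single
  intro c hc
  refine ⟨(hc _).1 (dv_val n n (by omega)), fun j => ?_⟩
  have h1 := stp_cases n n (by omega) c j
  generalize stp (DMatrix n) c (dv n n) j = v at *
  have := hc j
  have := j.2
  unfold DHalf at h1
  omega

lemma tr_down_step (m : ℕ) (hm : 2 ≤ m) (hmn : m < n) :
    Tr n (ID n (m+1)) [dv n (m+1)] (ID n m) := by
  apply Tr.single
  intro c hc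
  refine ⟨(hc _).1 (dv_val n (m+1) (by omega)), fun j => ?_⟩
  have h1 := stp_cases n (m+1) (by omega) c j
  generalize stp (DMatrix n) c (dv n (m+1)) j = v at *
  have := hc j
  have := j.2
  unfold DHalf at h1
  omega

lemma tr_down_last (hn : 2 ≤ n) : Tr n (ID n 2) [dv n 2] (ED n) := by
  apply Tr.single
  intro c hc
  refine ⟨(hc _).1 (dv_val n 2 (by omega)), fun j => ?_⟩
  have h1 := stp_cases n 2 (by omega) c j
  generalize stp (DMatrix n) c (dv n 2) j = v at *
  have := hc j
  have := j.2
  unfold DHalf at h1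
  omega

/-- The word `s_2 ⋯ s_n`. -/
def UW (n : ℕ) : List (Fin (n+3)) := (List.range' 2 (n-1)).map (dv n)

lemma tr_up_aux (d : ℕ) : ∀ m, 2 ≤ m → m + d = n →
    Tr n (IU n m) ((List.range' m (d+1)).map (dv n)) (EU n) := by
  induction d with
  | zero =>
    intro m hm hd
    obtain rfl : m = n := by omega
    exact tr_up_last hm
  | succ d ih =>
    intro m hm hd
    rw [List.range'_succ, List.map_cons]
    exact Tr.append (tr_up_step m hm (by omega)) (ih (m+1) (by omega) (by omega))

lemma tr_up (hn : 2 ≤ n) : Tr n (SU n) (UW n) (EU n) := by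
  have h := tr_up_aux (n := n) (n-2) 2 le_rfl (by omega)
  rw [show n - 2 + 1 = n - 1 by omega] at h
  refine h.weaken fun c hc j => ?_
  have := hc j
  omega

lemma tr_down_aux (hn : 2 ≤ n) (d : ℕ) : d + 2 ≤ n →
    Tr n (ID n (d + 2)) ((List.range' 2 (d+1)).map (dv n)).reverse (ED n) := by
  induction d with
  | zero => intro _; exact tr_down_last hn
  | succ d ih =>
    intro hd
    rw [List.range'_1_concat, List.map_append, List.reverse_append]
    refine Tr.append (Q := ID n (d+2)) ?_ (ih (by omega))
    have := tr_down_step (n := n) (d+2) (by omega) (by omega)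
    simpa [add_comm, add_left_comm] using this

lemma tr_down (hn : 2 ≤ n) : Tr n (SD n) (UW n).reverse (ED n) := by
  have h := tr_down_aux (n := n) hn (n-2) (by omega)
  rw [show n - 2 + 1 = n - 1 by omega, show n - 2 + 2 = n by omega] at h
  refine h.weaken fun c hc j => ?_
  have := hc j
  omega

lemma tr_pair {a b : ℕ}
    (h1 : ∀ c, P c → 2 ≤ c (dv n a))
    (h2 : ∀ c, P c → 2 ≤ stp (DMatrix n) c (dv n a) (dv n b))
    (h3 : ∀ c, P c → Q (stp (DMatrix n) (stp (DMatrix n) c (dv n a)) (dv n b))) :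
    Tr n P [dv n a, dv n b] Q :=
  fun c hc => ⟨⟨h1 c hc, h2 c hc, trivial⟩, h3 c hc⟩

lemma stp_right (hn : 2 ≤ n) (k : ℕ) (hk : k = n+1 ∨ k = n+2) (c : Fin (n+3) → ℕ) (j : Fin (n+3)) :
    ((j : ℕ) = k ∧ stp (DMatrix n) c (dv n k) j = 0) ∨
    ((j : ℕ) = n ∧ stp (DMatrix n) c (dv n k) j = c j + 1) ∨
    ((j : ℕ) ≠ k ∧ (j : ℕ) ≠ n ∧ stp (DMatrix n) c (dv n k) j = c j) := by
  have hj := j.2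
  rcases stp_cases n k (by omega) c j with h | ⟨h1, h2, h3⟩ | ⟨h1, h2, h3⟩
  · exact Or.inl h
  · refine Or.inr (Or.inl ⟨?_, h3⟩)
    unfold DHalf at h2
    omega
  · refine Or.inr (Or.inr ⟨h1, ?_, h3⟩)
    unfold DHalf at h2
    omega

lemma stp_left (hn : 2 ≤ n) (k : ℕ) (hk : k = 0 ∨ k = 1) (c : Fin (n+3) → ℕ) (j : Fin (n+3)) :
    ((j : ℕ) = k ∧ stp (DMatrix n) c (dv n k) j = 0) ∨
    ((j : ℕ) = 2 ∧ stp (DMatrix n) c (dv n k) j = c j + 1) ∨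
    ((j : ℕ) ≠ k ∧ (j : ℕ) ≠ 2 ∧ stp (DMatrix n) c (dv n k) j = c j) := by
  have hj := j.2
  rcases stp_cases n k (by omega) c j with h | ⟨h1, h2, h3⟩ | ⟨h1, h2, h3⟩
  · exact Or.inl h
  · refine Or.inr (Or.inl ⟨?_, h3⟩)
    unfold DHalf at h2
    omega
  · refine Or.inr (Or.inr ⟨h1, ?_, h3⟩)
    unfold DHalf at h2
    omega

lemma tr_right (hn : 2 ≤ n) {a b : ℕ} (hab : (a = n+1 ∧ b = n+2) ∨ (a = n+2 ∧ b = n+1)) :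
    Tr n (EU n) [dv n a, dv n b] (SD n) := by
  have ha : a < n + 3 := by omega
  have hb : b < n + 3 := by omega
  refine tr_pair ?_ ?_ ?_
  · intro c hc
    exact (hc _).2 (by rw [dv_val n a ha]; omega)
  · intro c hc
    have := (hc (dv n b)).2 (by rw [dv_val n b hb]; omega)
    rw [stp_val n a ha, dv_val n b hb]
    split_ifs <;> omega
  · intro c hc j
    have := hc j
    have := j.2
    have h1 := stp_right hn b (by omega) (stp (DMatrix n) c (dv n a)) j
    have h2 := stp_right hn a (by omega) c j
    generalize stp (DMatrix n) (stp (DMatrix n) c (dv n a)) (dv n b) j = v at *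
    generalize stp (DMatrix n) c (dv n a) j = v' at *
    omega

lemma tr_left (hn : 2 ≤ n) {a b : ℕ} (hab : (a = 0 ∧ b = 1) ∨ (a = 1 ∧ b = 0)) :
    Tr n (ED n) [dv n a, dv n b] (SU n) := by
  have ha : a < n + 3 := by omega
  have hb : b < n + 3 := by omega
  refine tr_pair ?_ ?_ ?_
  · intro c hc
    exact (hc _).1 (by rw [dv_val n a ha]; omega)
  · intro c hc
    have := (hc (dv n b)).1 (by rw [dv_val n b hb]; omega)
    rw [stp_val n a ha, dv_val n b hb]
    split_ifs <;> omega
  · intro c hc j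
    have := hc j
    have := j.2
    have h1 := stp_left hn b (by omega) (stp (DMatrix n) c (dv n a)) j
    have h2 := stp_left hn a (by omega) c j
    generalize stp (DMatrix n) (stp (DMatrix n) c (dv n a)) (dv n b) j = v at *
    generalize stp (DMatrix n) c (dv n a) j = v' at *
    omega

lemma aWord_eq (hn : 2 ≤ n) : AWord n = UW n ++ [dv n (n+1), dv n (n+2)] := by
  unfold AWord UW
  obtain ⟨m, rfl⟩ : ∃ m, n = m + 1 := ⟨n - 1, by omega⟩
  rw [List.range'_1_concat, List.range'_1_concat]
  simp [add_comm, add_left_comm]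

lemma bWord_eq (hn : 2 ≤ n) : BWord n = (UW n).reverse ++ [dv n 1, dv n 0] := by
  unfold BWord UW
  obtain ⟨m, rfl⟩ : ∃ m, n = m + 1 := ⟨n - 1, by omega⟩
  rw [List.range_eq_range', List.range'_succ, List.range'_succ]
  simp

lemma tr_A (hn : 2 ≤ n) : Tr n (SU n) (AWord n) (SD n) := by
  rw [aWord_eq hn]; exact (tr_up hn).append (tr_right hn (by omega))

lemma tr_B (hn : 2 ≤ n) : Tr n (SD n) (BWord n) (SU n) := by
  rw [bWord_eq hn]; exact (tr_down hn).append (tr_left hn (by omega))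

lemma tr_Ar (hn : 2 ≤ n) : Tr n (EU n) (AWord n).reverse (ED n) := by
  rw [aWord_eq hn, List.reverse_append]
  exact Tr.append (tr_right hn (a := n+2) (b := n+1) (by omega)) (tr_down hn)

lemma tr_Br (hn : 2 ≤ n) : Tr n (ED n) (BWord n).reverse (EU n) := by
  rw [bWord_eq hn, List.reverse_append, List.reverse_reverse]
  exact Tr.append (tr_left hn (a := 0) (b := 1) (by omega)) (tr_up hn)

/-- Initial counters for a word starting at the left end. -/
def countL (n : ℕ) (j : Fin (n+3)) : ℕ := if (j : ℕ) < 2 then 2 else if (j : ℕ) = 2 then 0 else 1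

/-- Initial counters for a word starting at the right end. -/
def countR (n : ℕ) (j : Fin (n+3)) : ℕ := if n < (j : ℕ) then 2 else if (j : ℕ) = n then 0 else 1

lemma countL_ED : ED n (countL n) := by
  intro j; unfold countL; split_ifs <;> omega

lemma countR_EU : EU n (countR n) := by
  intro j; unfold countR; split_ifs <;> omega

lemma countL_start (hn : 2 ≤ n) (s t : Fin (n+3)) (h : (DMatrix n) s t = 3) (hs : 2 ≤ countL n s) :
    countL n t = 0 := by
  rw [dM_three] at h
  unfold countL at *
  unfold DAdj DHalf at h
  split_ifs at * <;> omega

lemma countR_start (hn : 2 ≤ n) (s t : Fin (n+3)) (h : (DMatrix n) s t = 3) (hs : 2 ≤ countR n s) :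
    countR n t = 0 := by
  rw [dM_three] at h
  unfold countR at *
  unfold DAdj DHalf at h
  have := s.2
  have := t.2
  split_ifs at * <;> omega

lemma acc_zig1 (hn : 2 ≤ n) (k h : ℕ) (hh : h ≤ 1) :
    Acc (DMatrix n) (countL n) (ZigWord1 n k h) := by
  have h1 : Tr n (ED n) ([dv n 0, dv n 1] ++ (List.replicate k (AWord n ++ BWord n)).flatten)
      (SU n) :=
    (tr_left hn (by omega)).append (((tr_A hn).append (tr_B hn)).rep k)
  unfold ZigWord1
  obtain rfl | rfl : h = 0 ∨ h = 1 := by omega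
  · exact (h1.append (y := []) Tr.nil _ countL_ED).1
  · have h2 := h1.append (tr_A hn) _ countL_ED
    simpa using h2.1

lemma acc_zig2 (hn : 2 ≤ n) (k h : ℕ) (hh : h ≤ 1) :
    Acc (DMatrix n) (countR n) (ZigWord2 n k h) := by
  have h1 : Tr n (EU n)
      ([dv n (n+2), dv n (n+1)] ++ (List.replicate k (BWord n ++ AWord n)).flatten) (SD n) :=
    (tr_right hn (by omega)).append (((tr_B hn).append (tr_A hn)).rep k)
  unfold ZigWord2
  obtain rfl | rfl : h = 0 ∨ h = 1 := by omega
  · exact (h1.append (y := []) Tr.nil _ countR_EU).1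
  · have h2 := h1.append (tr_B hn) _ countR_EU
    simpa using h2.1

lemma rev_rep {α : Type*} (k : ℕ) (x : List α) :
    (List.replicate k x).flatten.reverse = (List.replicate k x.reverse).flatten := by
  rw [List.reverse_flatten, List.map_replicate, List.reverse_replicate]

lemma acc_zig1_rev (hn : 2 ≤ n) (k h : ℕ) (hh : h ≤ 1) :
    ∃ d, Acc (DMatrix n) d (ZigWord1 n k h).reverse ∧
      ∀ s t, (DMatrix n) s t = 3 → 2 ≤ d s → d t = 0 := by
  have h1 : Tr n (ED n) ((List.replicate k (AWord n ++ BWord n)).flatten.reverse ++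
      [dv n 1, dv n 0]) (SU n) := by
    rw [rev_rep, List.reverse_append]
    exact (((tr_Br hn).append (tr_Ar hn)).rep k).append (tr_left hn (by omega))
  unfold ZigWord1
  rw [List.reverse_append, List.reverse_append]
  obtain rfl | rfl : h = 0 ∨ h = 1 := by omega
  · exact ⟨countL n, (h1 _ countL_ED).1, countL_start hn⟩
  · refine ⟨countR n, ?_, countR_start hn⟩
    have h2 := ((tr_Ar hn).append h1) _ countR_EU
    simpa using h2.1

lemma acc_zig2_rev (hn : 2 ≤ n) (k h : ℕ) (hh : h ≤ 1) :
    ∃ d, Acc (DMatrix n) d (ZigWord2 n k h).reverse ∧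
      ∀ s t, (DMatrix n) s t = 3 → 2 ≤ d s → d t = 0 := by
  have h1 : Tr n (EU n) ((List.replicate k (BWord n ++ AWord n)).flatten.reverse ++
      [dv n (n+1), dv n (n+2)]) (SD n) := by
    rw [rev_rep, List.reverse_append]
    exact (((tr_Ar hn).append (tr_Br hn)).rep k).append (tr_right hn (by omega))
  unfold ZigWord2
  rw [List.reverse_append, List.reverse_append]
  obtain rfl | rfl : h = 0 ∨ h = 1 := by omega
  · exact ⟨countR n, (h1 _ countR_EU).1, countR_start hn⟩
  · refine ⟨countL n, ?_, countL_start hn⟩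
    have h2 := ((tr_Br hn).append h1) _ countL_ED
    simpa using h2.1

lemma zig1_irred (hn : 2 ≤ n) {G : Type*} [Group G] (cs : CoxeterSystem (DMatrix n) G)
    (k h : ℕ) (hh : h ≤ 1) : StarIrreducible cs (cs.wordProd (ZigWord1 n k h)) := by
  obtain ⟨d, h1, h2⟩ := acc_zig1_rev hn k h hh
  exact star_irred_of_acc (dM_simply n) cs _ d _ (acc_zig1 hn k h hh) (countL_start hn) h1 h2

lemma zig2_irred (hn : 2 ≤ n) {G : Type*} [Group G] (cs : CoxeterSystem (DMatrix n) G)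
    (k h : ℕ) (hh : h ≤ 1) : StarIrreducible cs (cs.wordProd (ZigWord2 n k h)) := by
  obtain ⟨d, h1, h2⟩ := acc_zig2_rev hn k h hh
  exact star_irred_of_acc (dM_simply n) cs _ d _ (acc_zig2 hn k h hh) (countR_start hn) h1 h2

end Zig

theorem stmt15 (n : ℕ) (hn : 2 ≤ n) {W : Type*} [Group W]
    (cs : CoxeterSystem (DMatrix n) W)
    (k h : ℕ) (hh : h ≤ 1) (hkh : 0 < k + h) :
    (∀ w : W, IsCompleteZigzag cs w → StarIrreducible cs w) ∧
    IsFC cs (cs.wordProd (ZigWord1 n k h)) ∧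
    StarIrreducible cs (cs.wordProd (ZigWord1 n k h)) := by
  refine ⟨?_, good_fc (dM_simply n) cs _ (acc_good (acc_zig1 hn k h hh)), zig1_irred hn cs k h hh⟩
  rintro w ⟨k', h', hh', -, ⟨-, rfl⟩ | ⟨-, rfl⟩⟩
  · exact zig1_irred hn cs k' h' hh'
  · exact zig2_irred hn cs k' h' hh'


end CoxFC
end

section
/- Let W be the Coxeter group of affine type D̃_{n+2} and w ∈ FC(W) star irreducible. If w admits a reduced expression containing the factor s_0 s_1 (i.e. f_•(w) ≠ 0), and w is not a factor of any complete zigzag, then s_0, s_1 ∈ D_L(w) and f_•(w) = 1 (assuming w is left star irreducible; the same conclusion holds under left star irreducibility alone). -/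
open CoxeterSystem

namespace CoxFC


open CoxeterSystem


variable {B : Type*} {W : Type*} [Group W] {M : CoxeterMatrix B}

variable {n : ℕ} {W : Type*} [Group W]

section General

variable {B : Type*} {W : Type*} [Group W] {M : CoxeterMatrix B} (cs : CoxeterSystem M W)


lemma simple_comm {a b : B} (h : M a b = 2) :
    cs.simple a * cs.simple b = cs.simple b * cs.simple a := by
  have h1 := cs.simple_mul_simple_pow a b
  rw [h, pow_two] at h1
  have h2 := eq_inv_of_mul_eq_one_left h1
  simpa using h2

lemma simple_braid {a b : B} (h : M a b = 3) :
    cs.simple a * cs.simple b * cs.simple a = cs.simple b * cs.simple a * cs.simple b := by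
  have h1 := cs.simple_mul_simple_pow a b
  rw [h, pow_succ, pow_two] at h1
  have h2 : (cs.simple a * cs.simple b * cs.simple a) * (cs.simple b * cs.simple a * cs.simple b) = 1 := by
    rw [← h1]; group
  have h3 := eq_inv_of_mul_eq_one_left h2
  simpa [mul_assoc] using h3

lemma prod_comm {b : B} {p : List B} (h : ∀ a ∈ p, M b a = 2) :
    cs.simple b * cs.wordProd p = cs.wordProd p * cs.simple b := by
  induction p with
  | nil => simp
  | cons a p ih =>
    have h1 := simple_comm cs (h a (by simp))
    have h2 := ih (fun c hc => h c (by simp [hc]))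
    rw [cs.wordProd_cons, ← mul_assoc, h1, mul_assoc, h2, mul_assoc]

/-- `l` is a reduced word for `w`. -/
def Red (w : W) (l : List B) : Prop := cs.IsReduced l ∧ cs.wordProd l = w

variable {cs}

lemma Red.congr {w : W} {l l' : List B} (h : Red cs w l) (hl : l'.length = l.length)
    (hp : cs.wordProd l' = cs.wordProd l) : Red cs w l' := by
  obtain ⟨h1, h2⟩ := h
  refine ⟨?_, hp.trans h2⟩
  unfold CoxeterSystem.IsReduced at *
  rw [hp, h1, hl]

lemma CommEquiv.perm {l l' : List B} (h : CommEquiv M l l') : l.Perm l' := by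
  induction h with
  | refl => exact List.Perm.refl _
  | tail _ h ih =>
    obtain ⟨l1, l2, a, b, -, rfl, rfl⟩ := h
    exact ih.trans ((List.Perm.swap _ _ _).append_left _)

lemma Red.perm {w : W} (hw : IsFC cs w) {l l' : List B} (h : Red cs w l) (h' : Red cs w l') :
    l.Perm l' := (hw l l' h.1 h'.1 h.2 h'.2).perm

lemma Red.move {w : W} {u p v : List B} {b : B} (h : Red cs w (u ++ b :: (p ++ v)))
    (hp : ∀ a ∈ p, M b a = 2) : Red cs w (u ++ (p ++ b :: v)) := by
  refine h.congr (by simp; omega) ?_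
  simp only [cs.wordProd_append, cs.wordProd_cons, mul_assoc]
  rw [← mul_assoc (cs.simple b), prod_comm cs hp, mul_assoc]

lemma Red.move' {w : W} {u p v : List B} {b : B} (h : Red cs w (u ++ (p ++ b :: v)))
    (hp : ∀ a ∈ p, M b a = 2) : Red cs w (u ++ b :: (p ++ v)) := by
  refine h.congr (by simp; omega) ?_
  simp only [cs.wordProd_append, cs.wordProd_cons, mul_assoc]
  rw [← mul_assoc (cs.simple b), prod_comm cs hp, mul_assoc]

lemma Red.not_sq {w : W} {u v : List B} {b : B} (h : Red cs w (u ++ b :: b :: v)) : False := by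
  have h1 := h.1
  unfold CoxeterSystem.IsReduced at h1
  have h2 : cs.wordProd (u ++ b :: b :: v) = cs.wordProd (u ++ v) := by
    simp [cs.wordProd_append, cs.wordProd_cons]
  have h3 := cs.length_wordProd_le (u ++ v)
  rw [h2] at h1
  simp at h1 h3
  omega

/-- Letter `b` occurs in `c`, preceded only by commuting letters. -/
def St0 (M : CoxeterMatrix B) (c : List B) (b : B) : Prop :=
  ∃ p r, c = p ++ b :: r ∧ ∀ a ∈ p, M b a = 2

/-- Letter `b` occurs in `c`, preceded by exactly one non commuting letter. -/
def St1 (M : CoxeterMatrix B) (c : List B) (b : B) : Prop :=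
  ∃ p t q r, c = p ++ t :: (q ++ b :: r) ∧ M b t = 3 ∧ (∀ a ∈ p, M b a = 2) ∧ ∀ a ∈ q, M b a = 2

/-- `b` commutes with all letters of `c`. -/
def Cm (M : CoxeterMatrix B) (c : List B) (b : B) : Prop := ∀ a ∈ c, M b a = 2

lemma St0.self (c : List B) (b : B) : St0 M (b :: c) b := ⟨[], c, by simp, by simp⟩

lemma St0.cons {c : List B} {a b : B} (h : St0 M c b) (hab : M b a = 2) : St0 M (a :: c) b := by
  obtain ⟨p, r, rfl, hp⟩ := h
  exact ⟨a :: p, r, by simp, by simpa [hab] using hp⟩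

lemma St1.cons {c : List B} {a b : B} (h : St1 M c b) (hab : M b a = 2) : St1 M (a :: c) b := by
  obtain ⟨p, t, q, r, rfl, ht, hp, hq⟩ := h
  exact ⟨a :: p, t, q, r, by simp, ht, by simpa [hab] using hp, hq⟩

lemma St0.cons1 {c : List B} {a b : B} (h : St0 M c b) (hab : M b a = 3) : St1 M (a :: c) b := by
  obtain ⟨p, r, rfl, hp⟩ := h
  exact ⟨[], a, p, r, by simp, hab, by simp, hp⟩

lemma Cm.cons {c : List B} {a b : B} (h : Cm M c b) (hab : M b a = 2) : Cm M (a :: c) b := by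
  intro x hx
  rcases List.mem_cons.1 hx with rfl | hx
  · exact hab
  · exact h x hx

lemma St0.app {c : List B} {b : B} (d : List B) (h : St0 M c b) : St0 M (c ++ d) b := by
  obtain ⟨p, r, rfl, hp⟩ := h
  exact ⟨p, r ++ d, by simp, hp⟩

lemma St1.app {c : List B} {b : B} (d : List B) (h : St1 M c b) : St1 M (c ++ d) b := by
  obtain ⟨p, t, q, r, rfl, ht, hp, hq⟩ := h
  exact ⟨p, t, q, r ++ d, by simp, ht, hp, hq⟩

lemma Red.no_braid {w : W} (hw : IsFC cs w) {u v : List B} {b t : B} (hbt : M b t = 3)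
    (h : Red cs w (u ++ b :: t :: b :: v)) : False := by
  have h' : Red cs w (u ++ t :: b :: t :: v) := by
    refine h.congr (by simp) ?_
    have := simple_braid cs hbt
    simp only [cs.wordProd_append, cs.wordProd_cons]
    simp only [← mul_assoc]
    rw [mul_assoc (cs.wordProd u), mul_assoc (cs.wordProd u), ← this]
    simp only [mul_assoc]
  have hp := h.perm hw h'
  classical
  have hne : t ≠ b := by
    rintro rfl
    simp [M.diagonal] at hbt
  have := hp.count_eq b
  simp [List.count_cons, hne] at this

lemma Red.no_st0 {w : W} {u v c : List B} {b : B} (h : Red cs w (u ++ b :: (c ++ v)))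
    (hs : St0 M c b) : False := by
  obtain ⟨p, r, rfl, hp⟩ := hs
  have h1 : Red cs w (u ++ b :: (p ++ (b :: (r ++ v)))) := by simpa using h
  have h2 := h1.move hp
  rw [← List.append_assoc] at h2
  exact h2.not_sq

lemma Red.no_st1 {w : W} (hw : IsFC cs w) {u v c : List B} {b : B}
    (h : Red cs w (u ++ b :: (c ++ v))) (hs : St1 M c b) : False := by
  obtain ⟨p, t, q, r, rfl, ht, hp, hq⟩ := hs
  have h1 : Red cs w (u ++ b :: (p ++ (t :: (q ++ b :: r) ++ v))) := by simpa using h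
  have h2 := h1.move hp
  have h3 : Red cs w ((u ++ p ++ [b, t]) ++ (q ++ b :: (r ++ v))) := by simpa using h2
  have h4 := h3.move' hq
  have h5 : Red cs w ((u ++ p) ++ b :: t :: b :: (q ++ (r ++ v))) := by simpa using h4
  exact h5.no_braid hw ht

lemma Red.reverse {w : W} {l : List B} (h : Red cs w l) : Red cs w⁻¹ l.reverse := by
  refine ⟨h.1.reverse, by rw [cs.wordProd_reverse, h.2]⟩

lemma IsFC.inv {w : W} (hw : IsFC cs w) : IsFC cs w⁻¹ := by
  intro l l' h1 h2 h3 h4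
  have h := hw l.reverse l'.reverse h1.reverse h2.reverse (by simp [h3]) (by simp [h4])
  have key : ∀ x y : List B, CommEquiv M x y → CommEquiv M x.reverse y.reverse := by
    intro x y hxy
    induction hxy with
    | refl => exact Relation.ReflTransGen.refl
    | tail _ hs ih =>
      refine ih.tail ?_
      obtain ⟨l1, l2, a, b, hab, rfl, rfl⟩ := hs
      exact ⟨l2.reverse, l1.reverse, b, a, by rw [M.symmetric]; exact hab, by simp, by simp⟩
  simpa using key _ _ h

lemma Red.descent {w : W} {l : List B} {a : B} (h : Red cs w (a :: l)) :
    cs.IsLeftDescent w a ∧ Red cs (cs.simple a * w) l := by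
  obtain ⟨h1, h2⟩ := h
  have h3 : cs.simple a * w = cs.wordProd l := by simp [← h2, cs.wordProd_cons]
  have h4 : cs.IsReduced l := by simpa using h1.drop 1
  refine ⟨?_, h4, h3.symm⟩
  unfold CoxeterSystem.IsLeftDescent
  rw [h3, h4.eq, ← h2, h1.eq]
  simp

lemma Red.not_irr {w : W} {l : List B} {a b : B} (h : Red cs w (a :: b :: l)) (hab : M a b = 3)
    (hirr : LeftStarIrreducible cs w) : False := by
  obtain ⟨h1, h2⟩ := h.descent
  exact hirr a b ⟨Or.inl hab.ge, h1, h2.descent.1⟩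

/-- Inverted form of forward step. -/
lemma Red.no_end {w : W} (hw : IsFC cs w) {v c : List B} {b : B}
    (h : Red cs w (c.reverse ++ b :: v)) (hs : St0 M c b ∨ St1 M c b) : False := by
  have h1 : Red cs w⁻¹ (v.reverse ++ b :: (c ++ [])) := by simpa using h.reverse
  rcases hs with hs | hs
  · exact h1.no_st0 hs
  · exact h1.no_st1 hw.inv hs

/-! ### numbers game -/

open Classical in
/-- One firing move of the numbers game. -/
noncomputable def fire (M : CoxeterMatrix B) (s : B) (x : B → ℤ) : B → ℤ :=
  fun b => if b = s then - x s else if M s b = 3 then x b + x s else x b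

lemma fire_fire (s : B) (x : B → ℤ) : fire M s (fire M s x) = x := by
  funext b
  unfold fire
  by_cases h : b = s
  · subst h; simp
  · by_cases h2 : M s b = 3 <;> simp [h, h2]

lemma fire_comm {s t : B} (h : M s t = 2) (x : B → ℤ) :
    fire M s (fire M t x) = fire M t (fire M s x) := by
  have hst : s ≠ t := by rintro rfl; simp [M.diagonal] at h
  have h' : M t s = 2 := by rw [M.symmetric]; exact h
  funext b
  unfold fire
  by_cases hs : b = s
  · subst hs; simp [hst, h, h']
  · by_cases ht : b = t
    · subst ht; simp [hs, h, h']
    · by_cases h1 : M s b = 3 <;> by_cases h2 : M t b = 3 <;>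
        simp [hs, ht, h1, h2, hst, hst.symm, h, h'] 
      ring

lemma fire_braid {s t : B} (h : M s t = 3) (x : B → ℤ) :
    fire M s (fire M t (fire M s x)) = fire M t (fire M s (fire M t x)) := by
  have hst : s ≠ t := by rintro rfl; simp [M.diagonal] at h
  have h' : M t s = 3 := by rw [M.symmetric]; exact h
  funext b
  unfold fire
  by_cases hs : b = s
  · subst hs; simp [hst, hst.symm, h, h']
  · by_cases ht : b = t
    · subst ht; simp [hs, Ne.symm hs, h, h']
    · by_cases h1 : M s b = 3 <;> by_cases h2 : M t b = 3 <;>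
        simp [hs, ht, h1, h2, hst, hst.symm, h, h'] <;> ring

/-- Firing as an element of the monoid of self maps. -/
noncomputable def fireEnd (M : CoxeterMatrix B) (s : B) : Function.End (B → ℤ) := fire M s

lemma fire_liftable (hM : ∀ a b, a ≠ b → M a b = 2 ∨ M a b = 3) :
    M.IsLiftable (fireEnd M) := by
  intro a b
  by_cases hab : a = b
  · subst hab
    rw [M.diagonal, pow_one]
    funext x
    exact fire_fire a x
  · rcases hM a b hab with h | h
    · rw [h]
      funext x
      change fire M a (fire M b (fire M a (fire M b x))) = x
      rw [fire_comm h (fire M a (fire M b x)), fire_fire, fire_fire]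
    · rw [h]
      funext x
      change fire M a (fire M b (fire M a (fire M b (fire M a (fire M b x))))) = x
      rw [fire_braid h, fire_fire b, fire_fire a, fire_fire b]

/-- The right action of `W` on states of the numbers game. -/
noncomputable def act (cs : CoxeterSystem M W) (hM : ∀ a b, a ≠ b → M a b = 2 ∨ M a b = 3)
    (x : B → ℤ) (w : W) : B → ℤ :=
  (cs.lift ⟨fireEnd M, fire_liftable hM⟩ : W →* Function.End (B → ℤ)) w⁻¹ x

variable (hM : ∀ a b, a ≠ b → M a b = 2 ∨ M a b = 3)

lemma act_one (x : B → ℤ) : act cs hM x 1 = x := by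
  unfold act
  simp
  rfl

lemma act_mul_simple (x : B → ℤ) (w : W) (s : B) :
    act cs hM x (w * cs.simple s) = fire M s (act cs hM x w) := by
  unfold act
  rw [mul_inv_rev, cs.inv_simple, map_mul, cs.lift_apply_simple]
  rfl

lemma act_nonneg (x : B → ℤ) (hx : ∀ b, 0 ≤ x b) : ∀ (N : ℕ) (w : W), cs.length w = N →
    ∀ s, cs.length (w * cs.simple s) = cs.length w + 1 → 0 ≤ act cs hM x w s := by
  intro N
  induction N using Nat.strong_induction_on with
  | _ N ih =>
  intro w hN s hs
  by_cases hw1 : w = 1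
  · subst hw1
    rw [act_one]; exact hx s
  obtain ⟨t, ht⟩ := cs.exists_rightDescent_of_ne_one hw1
  rw [cs.isRightDescent_iff] at ht
  have hst : s ≠ t := by rintro rfl; omega
  obtain ⟨v, rfl⟩ : ∃ v, w = v * cs.simple t := ⟨w * cs.simple t, by simp⟩
  simp only [cs.simple_mul_simple_cancel_right] at ht
  have hvt : 0 ≤ act cs hM x v t := ih (cs.length v) (by omega) v rfl t (by omega)
  rw [act_mul_simple]
  rcases hM t s hst.symm with h | h
  · have hvs : cs.length (v * cs.simple s) = cs.length v + 1 := by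
      rcases cs.length_mul_simple v s with h1 | h1
      · exact h1
      · exfalso
        rw [mul_assoc, simple_comm cs h, ← mul_assoc] at hs
        have := cs.length_mul_simple (v * cs.simple s) t
        omega
    have := ih (cs.length v) (by omega) v rfl s hvs
    unfold fire
    simpa [hst, h] using this
  · rcases cs.length_mul_simple v s with h1 | h1
    · have := ih (cs.length v) (by omega) v rfl s h1
      unfold fire
      simp [hst, h]
      omega
    · obtain ⟨u, rfl⟩ : ∃ u, v = u * cs.simple s := ⟨v * cs.simple s, by simp⟩
      simp only [cs.simple_mul_simple_cancel_right] at h1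
      have hut : cs.length (u * cs.simple t) = cs.length u + 1 := by
        rcases cs.length_mul_simple u t with h2 | h2
        · exact h2
        · exfalso
          have h3 : M s t = 3 := by rw [M.symmetric]; exact h
          have e : u * cs.simple s * cs.simple t * cs.simple s
              = u * cs.simple t * cs.simple s * cs.simple t := by
            have := simple_braid cs h3
            simp only [mul_assoc] at this ⊢
            rw [this]
          rw [e] at hs
          have := cs.length_mul_simple (u * cs.simple t) s
          have := cs.length_mul_simple (u * cs.simple t * cs.simple s) t
          omega
      have := ih (cs.length u) (by omega) u rfl t hut
      have h3 : M s t = 3 := by rw [M.symmetric]; exact h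
      rw [act_mul_simple]
      unfold fire
      simpa [hst, hst.symm, h, h3] using this

lemma act_pos (x : B → ℤ) (hx : ∀ b, 0 ≤ x b) (w : W) (s : B) (h : 0 < act cs hM x w s) :
    cs.length (w * cs.simple s) = cs.length w + 1 := by
  rcases cs.length_mul_simple w s with h1 | h1
  · exact h1
  · exfalso
    obtain ⟨v, rfl⟩ : ∃ v, w = v * cs.simple s := ⟨w * cs.simple s, by simp⟩
    simp only [cs.simple_mul_simple_cancel_right] at h1
    have := act_nonneg (cs := cs) hM x hx _ v rfl s (by omega)
    rw [act_mul_simple] at h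
    unfold fire at h
    simp at h
    omega

end General
section TypeD

/-- Coordinate of a letter, possibly after flipping the diagram. -/
def co (n m : ℕ) (b : Fin (n+3)) : ℕ := if m % 2 = 0 then b.val else n + 2 - b.val

lemma co_inj {n m : ℕ} {a b : Fin (n+3)} : co n m a = co n m b ↔ a = b := by
  have := a.isLt
  have := b.isLt
  rw [Fin.ext_iff]
  unfold co
  split_ifs <;> omega

lemma co_le {n m : ℕ} (a : Fin (n+3)) : co n m a ≤ n + 2 := by
  have := a.isLt
  unfold co
  split_ifs <;> omega

lemma co_zero {n : ℕ} (a : Fin (n+3)) : co n 0 a = a.val := by simp [co]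

lemma co_succ {n m : ℕ} (a : Fin (n+3)) : co n (m+1) a = n + 2 - co n m a := by
  have := a.isLt
  unfold co
  split_ifs <;> omega

/-- Inverse of `co`. -/
def ph (n m j : ℕ) : Fin (n+3) := if m % 2 = 0 then dv n j else dv n (n + 2 - j)

lemma dv_val_s16 {n j : ℕ} (h : j ≤ n + 2) : (dv n j).val = j := by
  unfold dv
  simp
  omega

lemma co_ph {n m j : ℕ} (h : j ≤ n + 2) : co n m (ph n m j) = j := by
  unfold co ph
  split_ifs
  · exact dv_val_s16 h
  · rw [dv_val_s16 (by omega)]; omega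

lemma eq_ph {n m j : ℕ} {a : Fin (n+3)} (h : co n m a = j) : a = ph n m j := by
  rw [← co_inj (m := m), co_ph, h]
  rw [← h]; exact co_le a

lemma dadj_mid {n p q : ℕ} (h1 : 2 ≤ q) (h2 : q ≤ n) :
    DAdj n p q ↔ p = q + 1 ∨ p + 1 = q ∨ (q = 2 ∧ p = 0) ∨ (q = n ∧ p = n + 2) := by
  unfold DAdj DHalf; omega

lemma dadj_end {n p q : ℕ} (hn : 2 ≤ n) (h1 : n + 1 ≤ q) (h2 : q ≤ n + 2) :
    DAdj n p q ↔ p = n := by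
  unfold DAdj DHalf; omega

lemma dhalf_flip {n a b : ℕ} (hn : 2 ≤ n) (h : DHalf n a b) :
    DHalf n (n + 2 - b) (n + 2 - a) := by
  unfold DHalf at *; omega

lemma dadj_flip {n a b : ℕ} (hn : 2 ≤ n) (ha : a ≤ n + 2) (hb : b ≤ n + 2) :
    DAdj n a b ↔ DAdj n (n + 2 - a) (n + 2 - b) := by
  constructor
  · rintro (h | h)
    · exact Or.inr (dhalf_flip hn h)
    · exact Or.inl (dhalf_flip hn h)
  · rintro (h | h)
    · have := dhalf_flip hn h
      rw [Nat.sub_sub_self ha, Nat.sub_sub_self hb] at this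
      exact Or.inr this
    · have := dhalf_flip hn h
      rw [Nat.sub_sub_self ha, Nat.sub_sub_self hb] at this
      exact Or.inl this

lemma dM3 {n : ℕ} (hn : 2 ≤ n) (m : ℕ) (a b : Fin (n+3)) :
    DMatrix n a b = 3 ↔ DAdj n (co n m a) (co n m b) := by
  have h1 : DMatrix n a b = 3 ↔ DAdj n a b := by
    change (if DAdj n a b then 3 else if a = b then 1 else 2) = 3 ↔ _
    split_ifs <;> simp_all
  rw [h1]
  have := a.isLt
  have := b.isLt
  unfold co
  split_ifs
  · rfl
  · exact dadj_flip hn (by omega) (by omega)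

lemma dM2 {n : ℕ} (hn : 2 ≤ n) (m : ℕ) (a b : Fin (n+3)) :
    DMatrix n a b = 2 ↔ co n m a ≠ co n m b ∧ ¬ DAdj n (co n m a) (co n m b) := by
  rw [← dM3 hn, Ne, co_inj]
  change (if DAdj n a b then 3 else if a = b then 1 else 2) = 2 ↔
    _ ∧ ¬ (if DAdj n a b then 3 else if a = b then 1 else 2) = 3
  split_ifs <;> simp_all

lemma dM23 {n : ℕ} (a b : Fin (n+3)) (h : a ≠ b) : DMatrix n a b = 2 ∨ DMatrix n a b = 3 := by
  change (if DAdj n a b then 3 else if a = b then 1 else 2) = 2 ∨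
    (if DAdj n a b then 3 else if a = b then 1 else 2) = 3
  split_ifs <;> simp_all

/-- Words obtained from `c0` by growing a zigzag to the left. -/
inductive Grow (n : ℕ) (c0 : List (Fin (n+3))) : ℕ → ℕ → List (Fin (n+3)) → Prop
  | start : Grow n c0 0 1 c0
  | run {m i c} (a : Fin (n+3)) (h : Grow n c0 m i c) (hi : 1 ≤ i) (hn : i < n)
      (ha : co n m a = i + 1) : Grow n c0 m (i+1) (a :: c)
  | half {m c} (a : Fin (n+3)) (h : Grow n c0 m n c) (ha : n + 1 ≤ co n m a) :
      Grow n c0 m (co n m a) (a :: c)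
  | full {m x c} (a : Fin (n+3)) (h : Grow n c0 m x c) (hx : n + 1 ≤ x)
      (ha : co n m a + x = 2 * n + 3) : Grow n c0 (m+1) 1 (a :: c)

variable {n : ℕ} {c0 : List (Fin (n+3))}

lemma Grow.bd (hn : 2 ≤ n) {m i c} (h : Grow n c0 m i c) : 1 ≤ i ∧ i ≤ n + 2 := by
  cases h with
  | start => omega
  | run => omega
  | half a h ha => have := co_le (m := m) a; omega
  | full => omega

/-- Letters at the front. -/
def ZS (n m i : ℕ) (b : Fin (n+3)) : Prop := (i = 1 ∧ co n m b ≤ 1) ∨ (2 ≤ i ∧ co n m b = i)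

/-- Letters allowed to extend. -/
def AS (n m i : ℕ) (b : Fin (n+3)) : Prop :=
  (i < n ∧ co n m b = i + 1) ∨ (i = n ∧ n + 1 ≤ co n m b) ∨ (n + 1 ≤ i ∧ co n m b + i = 2 * n + 3)

/-- The invariant of a growing word. -/
def Inv {n : ℕ} (Z A : Fin (n+3) → Prop) (c : List (Fin (n+3))) : Prop :=
  (∀ b, Z b → St0 (DMatrix n) c b) ∧
  ∀ b, A b ∨ St0 (DMatrix n) c b ∨ St1 (DMatrix n) c b ∨ Cm (DMatrix n) c b

lemma Inv.step {Z A Z' A' : Fin (n+3) → Prop} {c : List (Fin (n+3))} {a : Fin (n+3)}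
    (h : Inv Z A c)
    (hZ : ∀ b, Z' b → b = a ∨ (Z b ∧ DMatrix n b a = 2))
    (hA : ∀ b, A' b ∨ b = a ∨ (DMatrix n b a = 2 ∧ ¬ A b) ∨ (DMatrix n b a = 3 ∧ Z b)) :
    Inv Z' A' (a :: c) := by
  constructor
  · intro b hb
    rcases hZ b hb with rfl | ⟨h1, h2⟩
    · exact St0.self _ _
    · exact (h.1 b h1).cons h2
  · intro b
    rcases hA b with h1 | rfl | ⟨h1, h2⟩ | ⟨h1, h2⟩
    · exact Or.inl h1
    · exact Or.inr (Or.inl (St0.self _ _))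
    · rcases h.2 b with h3 | h3 | h3 | h3
      · exact absurd h3 h2
      · exact Or.inr (Or.inl (h3.cons h1))
      · exact Or.inr (Or.inr (Or.inl (h3.cons h1)))
      · exact Or.inr (Or.inr (Or.inr (h3.cons h1)))
    · exact Or.inr (Or.inr (Or.inl ((h.1 b h2).cons1 h1)))

lemma Grow.inv (hn : 2 ≤ n) (h0 : Inv (ZS n 0 1) (AS n 0 1) c0) {m i c}
    (h : Grow n c0 m i c) : Inv (ZS n m i) (AS n m i) c := by
  induction h with
  | start => exact h0
  | @run m i c a h hi hin ha ih =>
    have hadj : ∀ b, DAdj n (co n m b) (co n m a) ↔ _ :=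
      fun b => dadj_mid (n := n) (p := co n m b) (q := co n m a) (by omega) (by omega)
    apply ih.step
    · intro b hb
      have := co_le (m := m) b
      rw [← co_inj (m := m), dM2 hn m, hadj]
      unfold ZS at *
      generalize co n m b = p at *
      omega
    · intro b
      have := co_le (m := m) b
      rw [← co_inj (m := m), dM2 hn m, dM3 hn m, hadj]
      unfold ZS AS at *
      generalize co n m b = p at *
      omega
  | @half m c a h ha ih =>
    have := co_le (m := m) a
    have hadj : ∀ b, DAdj n (co n m b) (co n m a) ↔ _ :=
      fun b => dadj_end (n := n) (p := co n m b) (q := co n m a) hn (by omega) (by omega)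
    apply ih.step
    · intro b hb
      have := co_le (m := m) b
      rw [← co_inj (m := m), dM2 hn m, hadj]
      unfold ZS at *
      generalize co n m b = p at *
      omega
    · intro b
      have := co_le (m := m) b
      rw [← co_inj (m := m), dM2 hn m, dM3 hn m, hadj]
      unfold ZS AS at *
      generalize co n m b = p at *
      omega
  | @full m x c a h hx ha ih =>
    have := co_le (m := m) a
    have := h.bd hn
    have hadj : ∀ b, DAdj n (co n m b) (co n m a) ↔ _ :=
      fun b => dadj_end (n := n) (p := co n m b) (q := co n m a) hn (by omega) (by omega)
    apply ih.step
    · intro b hb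
      have := co_le (m := m) b
      rw [← co_inj (m := m), dM2 hn m, hadj]
      unfold ZS at *
      rw [co_succ] at hb
      generalize co n m b = p at *
      omega
    · intro b
      have := co_le (m := m) b
      rw [← co_inj (m := m), dM2 hn m, dM3 hn m, hadj]
      unfold ZS AS at *
      rw [co_succ]
      generalize co n m b = p at *
      omega

lemma Grow.next (hn : 2 ≤ n) {m i c} (h : Grow n c0 m i c) {b} (hb : AS n m i b) :
    ∃ m' i', (m' ≠ 0 ∨ i' ≠ 1) ∧ Grow n c0 m' i' (b :: c) := by
  have hbd := h.bd hn
  rcases hb with ⟨h1, h2⟩ | ⟨rfl, h2⟩ | ⟨h1, h2⟩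
  · exact ⟨m, i+1, by omega, h.run b hbd.1 h1 h2⟩
  · exact ⟨m, co i m b, by omega, h.half b h2⟩
  · exact ⟨m+1, 1, by omega, h.full b h1 h2⟩

lemma Grow.step (hn : 2 ≤ n) (h0 : Inv (ZS n 0 1) (AS n 0 1) c0) {m i c}
    (h : Grow n c0 m i c) (b) :
    (∃ m' i', (m' ≠ 0 ∨ i' ≠ 1) ∧ Grow n c0 m' i' (b :: c)) ∨ St0 (DMatrix n) c b ∨
      St1 (DMatrix n) c b ∨ Cm (DMatrix n) c b := by
  rcases (h.inv hn h0).2 b with h1 | h1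
  · exact Or.inl (h.next hn h1)
  · exact Or.inr h1

lemma Grow.base {m i c} (h : Grow n c0 m i c) :
    ∃ f, c = f ++ c0 ∧ ∀ d0, Grow n d0 m i (f ++ d0) := by
  induction h with
  | start => exact ⟨[], by simp, fun d0 => by simpa using Grow.start⟩
  | run a h hi hin ha ih =>
    obtain ⟨f, rfl, hf⟩ := ih
    exact ⟨a :: f, by simp, fun d0 => (hf d0).run a hi hin ha⟩
  | half a h ha ih =>
    obtain ⟨f, rfl, hf⟩ := ih
    exact ⟨a :: f, by simp, fun d0 => (hf d0).half a ha⟩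
  | full a h hx ha ih =>
    obtain ⟨f, rfl, hf⟩ := ih
    exact ⟨a :: f, by simp, fun d0 => (hf d0).full a hx ha⟩

lemma Grow.progress1 (hn : 2 ≤ n) (N : ℕ) : ∀ {m i c}, Grow n c0 m i c → n + 2 - i ≤ N →
    ∃ x, Grow n c0 (m+1) 1 (x ++ c) := by
  induction N with
  | zero =>
    intro m i c h hN
    have hb := h.bd hn
    exact ⟨[ph n m (2*n+3-i)], h.full _ (by omega) (by rw [co_ph (by omega)]; omega)⟩
  | succ N ih =>
    intro m i c h hN
    have hb := h.bd hn
    rcases lt_trichotomy i n with h1 | h1 | h1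
    · obtain ⟨x, hx⟩ := ih (h.run (ph n m (i+1)) hb.1 h1 (co_ph (by omega))) (by omega)
      exact ⟨x ++ [ph n m (i+1)], by simpa using hx⟩
    · subst h1
      obtain ⟨x, hx⟩ := ih (h.half (ph i m (i+1)) (by rw [co_ph (by omega)]))
        (by rw [co_ph (by omega)]; omega)
      exact ⟨x ++ [ph i m (i+1)], by simpa using hx⟩
    · exact ⟨[ph n m (2*n+3-i)], h.full _ (by omega) (by rw [co_ph (by omega)]; omega)⟩

lemma Grow.progress (hn : 2 ≤ n) {m i c} (h : Grow n c0 m i c) :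
    ∃ x k, Grow n c0 (2*k) 1 (x ++ c) := by
  obtain ⟨x, hx⟩ := Grow.progress1 hn _ h le_rfl
  obtain ⟨k, hk⟩ | ⟨k, hk⟩ := Nat.even_or_odd (m+1)
  · exact ⟨x, k, by rw [two_mul, ← hk]; exact hx⟩
  · obtain ⟨y, hy⟩ := Grow.progress1 hn _ hx le_rfl
    refine ⟨y ++ x, k+1, ?_⟩
    rw [show 2*(k+1) = m+1+1 by omega]
    simpa using hy

lemma Grow.exists_all (hn : 2 ≤ n) (m : ℕ) : ∃ c, Grow n c0 m 1 c := by
  induction m with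
  | zero => exact ⟨c0, Grow.start⟩
  | succ m ih =>
    obtain ⟨c, hc⟩ := ih
    obtain ⟨x, hx⟩ := Grow.progress1 hn _ hc le_rfl
    exact ⟨_, hx⟩

/-- The initial word. -/
def EE (n : ℕ) : List (Fin (n+3)) := [dv n 0, dv n 1]

lemma inv_EE (hn : 2 ≤ n) : Inv (ZS n 0 1) (AS n 0 1) (EE n) := by
  have h0 : (dv n 0).val = 0 := dv_val_s16 (by omega)
  have h1 : (dv n 1).val = 1 := dv_val_s16 (by omega)
  have key : ∀ b : Fin (n+3), b.val ≤ 1 → St0 (DMatrix n) (EE n) b := by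
    intro b hb
    rcases Nat.lt_or_ge b.val 1 with hb1 | hb1
    · have : b = dv n 0 := Fin.ext (by omega)
      subst this
      exact St0.self _ _
    · have : b = dv n 1 := Fin.ext (by omega)
      subst this
      refine (St0.self _ _).cons ?_
      rw [dM2 hn 0, co_zero, co_zero, h0, h1]
      unfold DAdj DHalf
      omega
  constructor
  · intro b hb
    apply key
    unfold ZS at hb
    rw [co_zero] at hb
    omega
  · intro b
    by_cases hb : b.val ≤ 1
    · exact Or.inr (Or.inl (key b hb))
    · by_cases hb2 : b.val = 2
      · left
        unfold AS
        rw [co_zero]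
        omega
      · right; right; right
        intro a ha
        rw [dM2 hn 0, co_zero, co_zero]
        unfold EE at ha
        simp only [List.mem_cons, List.not_mem_nil, or_false] at ha
        rcases ha with rfl | rfl
        · rw [h0]; unfold DAdj DHalf; omega
        · rw [h1]; unfold DAdj DHalf; omega

lemma Grow.head (hn : 2 ≤ n) {m i c} (h : Grow n (EE n) m i c) :
    ∃ b r, c = b :: r ∧ ZS n m i b := by
  cases h with
  | start => exact ⟨dv n 0, [dv n 1], rfl, Or.inl ⟨rfl, by rw [co_zero, dv_val_s16 (by omega)]; omega⟩⟩
  | @run m i c a h hi hin ha => exact ⟨a, c, rfl, Or.inr ⟨by omega, ha⟩⟩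
  | @half m c a h ha => exact ⟨a, c, rfl, Or.inr ⟨by omega, rfl⟩⟩
  | @full m x c a h hx ha =>
    have := h.bd hn
    exact ⟨a, c, rfl, Or.inl ⟨by omega, by rw [co_succ]; omega⟩⟩

lemma Grow.head2 (hn : 2 ≤ n) {m i c} (h : Grow n (EE n) m i c) (hi : i ≠ 1) :
    ∃ a b r, c = a :: b :: r ∧ DMatrix n a b = 3 := by
  cases h with
  | start => exact absurd rfl hi
  | @run m i c a h hi hin ha =>
    obtain ⟨b, r, rfl, hb⟩ := h.head hn
    refine ⟨a, b, r, rfl, ?_⟩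
    rw [dM3 hn m]
    unfold ZS at hb
    unfold DAdj DHalf
    omega
  | @half m c a h ha =>
    obtain ⟨b, r, rfl, hb⟩ := h.head hn
    refine ⟨a, b, r, rfl, ?_⟩
    rw [dM3 hn m]
    have := co_le (m := m) a
    unfold ZS at hb
    unfold DAdj DHalf
    omega
  | @full m x c a h hx ha => exact absurd rfl hi

lemma Grow.zero_one (hn : 2 ≤ n) {c} (h : Grow n c0 0 1 c) : c = c0 := by
  generalize hm : (0:ℕ) = m at h
  generalize hi : (1:ℕ) = i at h
  cases h with
  | start => rfl
  | run => omega
  | half a h ha => omega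
  | full => omega

lemma Grow.shape (hn : 2 ≤ n) {m i c} (h : Grow n (EE n) m i c) :
    (∀ b : Fin (n+3), (0 < m ∨ (b.val ≤ i ∧ i ≤ n) ∨ (n+1 ≤ i ∧ (b.val ≤ n ∨ b.val = i))) →
      b ∈ c ∧ (b.val = 2 ∨ St0 (DMatrix n) c.reverse b ∨ St1 (DMatrix n) c.reverse b)) ∧
    (∀ b : Fin (n+3), b.val ≤ 1 → St0 (DMatrix n) c.reverse b) ∧
    (m = 0 → (i = 1 → c = EE n) ∧
      (2 ≤ i → i ≤ n → ∃ t p, c = t :: p ∧ t.val = i ∧ ∀ a ∈ p, a.val < i) ∧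
      (n + 1 ≤ i → ∃ x t p, c = x :: t :: p ∧ x.val = i ∧ t.val = n ∧ ∀ a ∈ p, a.val < n)) := by
  have h0 : (dv n 0).val = 0 := dv_val_s16 (by omega)
  have h1 : (dv n 1).val = 1 := dv_val_s16 (by omega)
  induction h with
  | start =>
    have key : ∀ b : Fin (n+3), b.val ≤ 1 → b ∈ EE n ∧ St0 (DMatrix n) (EE n).reverse b := by
      intro b hb
      rcases Nat.lt_or_ge b.val 1 with hb1 | hb1
      · have : b = dv n 0 := Fin.ext (by omega)
        subst this
        refine ⟨by simp [EE], ?_⟩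
        have : St0 (DMatrix n) [dv n 1, dv n 0] (dv n 0) := by
          refine (St0.self _ _).cons ?_
          rw [dM2 hn 0, co_zero, co_zero, h0, h1]
          unfold DAdj DHalf
          omega
        simpa [EE] using this
      · have : b = dv n 1 := Fin.ext (by omega)
        subst this
        refine ⟨by simp [EE], ?_⟩
        have : St0 (DMatrix n) [dv n 1, dv n 0] (dv n 1) := St0.self _ _
        simpa [EE] using this
    refine ⟨fun b hb => ?_, fun b hb => (key b hb).2, fun _ => ⟨fun _ => rfl, by omega, by omega⟩⟩
    have := key b (by omega)
    exact ⟨this.1, Or.inr (Or.inl this.2)⟩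
  | @run m i c a h hi hin ha ih =>
    obtain ⟨i1, i2, i3⟩ := ih
    have hshape : m = 0 → 2 ≤ i → ∃ t p, c = t :: p ∧ t.val = i ∧ ∀ a ∈ p, a.val < i :=
      fun hm hi2 => (i3 hm).2.1 hi2 hin.le
    refine ⟨fun b hb => ?_, fun b hb => ?_, fun hm => ⟨by omega, fun _ _ => ?_, by omega⟩⟩
    · by_cases hold : 0 < m ∨ b.val ≤ i
      · obtain ⟨j1, j2⟩ := i1 b (by omega)
        refine ⟨by simp [j1], ?_⟩
        rw [List.reverse_cons]
        rcases j2 with j2 | j2 | j2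
        · exact Or.inl j2
        · exact Or.inr (Or.inl (j2.app _))
        · exact Or.inr (Or.inr (j2.app _))
      · have hm : m = 0 := by omega
        subst hm
        rw [co_zero] at ha
        have hba : b = a := Fin.ext (by omega)
        subst hba
        refine ⟨by simp, ?_⟩
        by_cases hb2 : b.val = 2
        · exact Or.inl hb2
        right; right
        obtain ⟨t, p, rfl, ht, hp⟩ := hshape rfl (by omega)
        clear i3 hshape i1 i2
        refine ⟨p.reverse, t, [], [], by simp, ?_, ?_, by simp⟩
        · rw [dM3 hn 0, co_zero, co_zero]; unfold DAdj DHalf; omega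
        · intro x hx
          have := hp x (by simpa using hx)
          rw [dM2 hn 0, co_zero, co_zero]; unfold DAdj DHalf; omega
    · rw [List.reverse_cons]
      exact (i2 b hb).app _
    · subst hm
      rw [co_zero] at ha
      refine ⟨a, c, rfl, ha, fun x hx => ?_⟩
      rcases Nat.lt_or_ge i 2 with hi2 | hi2
      · have := (i3 rfl).1 (by omega)
        subst this
        unfold EE at hx
        simp only [List.mem_cons, List.not_mem_nil, or_false] at hx
        rcases hx with rfl | rfl <;> omega
      · obtain ⟨t, p, rfl, ht, hp⟩ := hshape rfl hi2
        rcases List.mem_cons.1 hx with rfl | hx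
        · omega
        · have := hp x hx; omega
  | @half m c a h ha ih =>
    obtain ⟨i1, i2, i3⟩ := ih
    have hal := co_le (m := m) a
    refine ⟨fun b hb => ?_, fun b hb => ?_, fun hm => ⟨by omega, by omega, fun _ => ?_⟩⟩
    · by_cases hold : 0 < m ∨ b.val ≤ n
      · obtain ⟨j1, j2⟩ := i1 b (by omega)
        refine ⟨by simp [j1], ?_⟩
        rw [List.reverse_cons]
        rcases j2 with j2 | j2 | j2
        · exact Or.inl j2
        · exact Or.inr (Or.inl (j2.app _))
        · exact Or.inr (Or.inr (j2.app _))
      · have hm : m = 0 := by omega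
        subst hm
        rw [co_zero] at *
        have hba : b = a := Fin.ext (by omega)
        subst hba
        refine ⟨by simp, ?_⟩
        right; right
        obtain ⟨t, p, rfl, ht, hp⟩ := (i3 rfl).2.1 hn le_rfl
        refine ⟨p.reverse, t, [], [], by simp, ?_, ?_, by simp⟩
        · rw [dM3 hn 0, co_zero, co_zero]; unfold DAdj DHalf; omega
        · intro x hx
          have := hp x (by simpa using hx)
          rw [dM2 hn 0, co_zero, co_zero]; unfold DAdj DHalf; omega
    · rw [List.reverse_cons]
      exact (i2 b hb).app _
    · subst hm
      rw [co_zero] at *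
      obtain ⟨t, p, rfl, ht, hp⟩ := (i3 rfl).2.1 hn le_rfl
      exact ⟨a, t, p, rfl, rfl, ht, hp⟩
  | @full m x c a h hx ha ih =>
    obtain ⟨i1, i2, i3⟩ := ih
    have hal := co_le (m := m) a
    refine ⟨fun b hb => ?_, fun b hb => ?_, by omega⟩
    · have hbl := b.isLt
      by_cases hold : 0 < m ∨ b.val ≤ n ∨ b.val = x
      · obtain ⟨j1, j2⟩ := i1 b (by omega)
        refine ⟨by simp [j1], ?_⟩
        rw [List.reverse_cons]
        rcases j2 with j2 | j2 | j2
        · exact Or.inl j2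
        · exact Or.inr (Or.inl (j2.app _))
        · exact Or.inr (Or.inr (j2.app _))
      · have hm : m = 0 := by omega
        subst hm
        rw [co_zero] at *
        have hba : b = a := Fin.ext (by omega)
        subst hba
        refine ⟨by simp, ?_⟩
        right; right
        obtain ⟨y, t, p, rfl, hy, ht, hp⟩ := (i3 rfl).2.2 hx
        refine ⟨p.reverse, t, [y], [], by simp, ?_, ?_, ?_⟩
        · rw [dM3 hn 0, co_zero, co_zero]; unfold DAdj DHalf; omega
        · intro x hx
          have := hp x (by simpa using hx)
          rw [dM2 hn 0, co_zero, co_zero]; unfold DAdj DHalf; omega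
        · intro z hz
          rw [List.mem_singleton] at hz
          subst hz
          rw [dM2 hn 0, co_zero, co_zero]; unfold DAdj DHalf; omega
    · rw [List.reverse_cons]
      exact (i2 b hb).app _

lemma Grow.inv_reverse (hn : 2 ≤ n) {m c} (h : Grow n (EE n) m 1 c) (hm : 0 < m) :
    Inv (ZS n 0 1) (AS n 0 1) c.reverse := by
  obtain ⟨h1, h2, -⟩ := h.shape hn
  constructor
  · intro b hb
    apply h2
    unfold ZS at hb
    rw [co_zero] at hb
    omega
  · intro b
    rcases (h1 b (Or.inl hm)).2 with h3 | h3 | h3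
    · left; unfold AS; rw [co_zero]; omega
    · exact Or.inr (Or.inl h3)
    · exact Or.inr (Or.inr (Or.inl h3))

end TypeD
section Numbers

variable {n : ℕ} {W : Type*} [Group W] (cs : CoxeterSystem (DMatrix n) W)

/-- Values of the numbers game along a zigzag. -/
def num (n m i j : ℕ) : ℤ :=
  if i = 1 then
    if j ≤ 1 then -(m+1) else if j = 2 then m + 2 - (m % 2 : ℕ)
    else if n + 1 ≤ j then (m % 2 : ℕ) else 0
  else if i ≤ n then
    if j ≤ 1 then 1 - (m % 2 : ℕ) else if j = i then -(m + 2 - (m % 2 : ℕ))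
    else if n + 1 ≤ j then (if i = n then m + 2 else (m % 2 : ℕ))
    else if j = i + 1 then m + 2 - (m % 2 : ℕ) else 0
  else
    if j ≤ 1 then 1 - (m % 2 : ℕ) else if j = i then -(m + 2)
    else if n + 1 ≤ j then m + 2 else if j = n then (m % 2 : ℕ) else 0

lemma num_run {n m i p : ℕ} (hn : 2 ≤ n) (hi : 1 ≤ i) (hin : i < n) (hp : p ≤ n + 2) :
    num n m (i+1) p = if p = i + 1 then - num n m i p else
      if DAdj n p (i+1) then num n m i p + num n m i (i+1) else num n m i p := by
  rw [if_congr (dadj_mid (by omega) (by omega)) rfl rfl]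
  have := Nat.mod_lt m (show 2 > 0 by omega)
  generalize hv : m % 2 = e at *
  unfold num
  rw [hv]
  rcases Nat.lt_or_ge 1 i with h1 | h1
  · have h2 : i ≠ 1 := by omega
    have h3 : i ≤ n := by omega
    have h4 : i + 1 ≤ n := by omega
    have h5 : i ≠ n := by omega
    simp only [h2, h3, h4, h5, if_true, if_false]
    split_ifs <;> omega
  · have : i = 1 := by omega
    subst this
    have h4 : 1 + 1 ≤ n := by omega
    have h7 : ¬ (n + 1 ≤ 2) := by omega
    rcases Nat.lt_or_ge 2 p with hp2 | hp2
    · have g1 : ¬ p ≤ 1 := by omega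
      have g2 : p ≠ 2 := by omega
      have g3 : p ≠ 0 := by omega
      have g4 : p + 1 ≠ 2 := by omega
      simp only [g1, g2, g3, g4, h4, h7, Nat.reduceAdd, Nat.reduceEqDiff, Nat.reduceLeDiff,
        if_true, if_false, OfNat.ofNat_ne_one, false_or, and_false, true_and]
      split_ifs <;> omega
    · interval_cases p
      · simp [h4, h7]; omega
      · simp [h4, h7]; omega
      · simp [h4, h7]

lemma num_half {n m q p : ℕ} (hn : 2 ≤ n) (hq : n + 1 ≤ q) (hq2 : q ≤ n + 2) (hp : p ≤ n + 2) :
    num n m q p = if p = q then - num n m n p else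
      if DAdj n p q then num n m n p + num n m n q else num n m n p := by
  rw [if_congr (dadj_end hn hq hq2) rfl rfl]
  generalize hv : m % 2 = e at *
  unfold num
  rw [hv]
  have h2 : n ≠ 1 := by omega
  have h3 : q ≠ 1 := by omega
  have h4 : ¬ q ≤ n := by omega
  simp only [h2, h3, h4, le_refl, if_true, if_false]
  split_ifs <;> omega

lemma num_full {n m x q p : ℕ} (hn : 2 ≤ n) (hx : n + 1 ≤ x) (hq : n + 1 ≤ q)
    (hxq : q + x = 2 * n + 3) (hp : p ≤ n + 2) :
    num n (m+1) 1 (n + 2 - p) = if p = q then - num n m x p else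
      if DAdj n p q then num n m x p + num n m x q else num n m x p := by
  rw [if_congr (dadj_end hn hq (by omega)) rfl rfl]
  have h0 : (m + 1) % 2 = 1 - m % 2 := by omega
  have := Nat.mod_lt m (show 2 > 0 by omega)
  generalize hv : m % 2 = e at *
  unfold num
  rw [hv, h0]
  have h3 : x ≠ 1 := by omega
  have h4 : ¬ x ≤ n := by omega
  simp only [h3, h4, if_true, if_false]
  split_ifs <;> push_cast <;> omega

/-- Initial weight. -/
def x0 (n : ℕ) (b : Fin (n+3)) : ℤ := if b.val ≤ 1 then 1 else 0

lemma x0_nonneg (b : Fin (n+3)) : 0 ≤ x0 n b := by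
  unfold x0; split_ifs <;> simp

lemma num_b1 (hn : 2 ≤ n) (p : ℕ) :
    (if p = 1 then - (if p ≤ 1 then 1 else 0) else
      if DAdj n p 1 then (if p ≤ 1 then 1 else 0) + (if 1 ≤ 1 then 1 else 0)
      else (if p ≤ 1 then 1 else 0)) =
    (if p = 0 then 1 else if p = 1 then -1 else if p = 2 then 1 else 0 : ℤ) := by
  have : DAdj n p 1 ↔ p = 2 := by unfold DAdj DHalf; omega
  rw [if_congr this rfl rfl]
  rcases Nat.lt_or_ge 2 p with hp2 | hp2
  · have g1 : ¬ p ≤ 1 := by omega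
    have g2 : p ≠ 2 := by omega
    have g3 : p ≠ 0 := by omega
    have g4 : p ≠ 1 := by omega
    simp [g1, g2, g3, g4]
  · interval_cases p <;> simp

lemma num_b2 (hn : 2 ≤ n) (p : ℕ) :
    (if p = 0 then - (if p = 0 then 1 else if p = 1 then -1 else if p = 2 then 1 else 0) else
      if DAdj n p 0 then (if p = 0 then 1 else if p = 1 then -1 else if p = 2 then 1 else 0) +
        (if 0 = 0 then 1 else if 0 = 1 then -1 else if 0 = 2 then 1 else 0)
      else (if p = 0 then 1 else if p = 1 then -1 else if p = 2 then 1 else 0)) =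
    num n 0 1 p := by
  have : DAdj n p 0 ↔ p = 2 := by unfold DAdj DHalf; omega
  rw [if_congr this rfl rfl]
  unfold num
  rcases Nat.lt_or_ge 2 p with hp2 | hp2
  · have g1 : ¬ p ≤ 1 := by omega
    have g2 : p ≠ 2 := by omega
    have g3 : p ≠ 0 := by omega
    have g4 : p ≠ 1 := by omega
    simp [g1, g2, g3, g4]
  · interval_cases p <;> simp

lemma fire_co (hn : 2 ≤ n) (m : ℕ) (a b : Fin (n+3)) (x : Fin (n+3) → ℤ) (f : ℕ → ℤ)
    (hx : ∀ b, x b = f (co n m b)) :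
    fire (DMatrix n) a x b = if co n m b = co n m a then - f (co n m b) else
      if DAdj n (co n m b) (co n m a) then f (co n m b) + f (co n m a) else f (co n m b) := by
  unfold fire
  by_cases h : b = a
  · subst h
    simp [hx]
  · have h' : co n m b ≠ co n m a := fun hh => h (co_inj.1 hh)
    by_cases h3 : DMatrix n b a = 3
    · have h3' : DMatrix n a b = 3 := by rw [(DMatrix n).symmetric]; exact h3
      rw [if_neg h, if_neg h', if_pos h3', if_pos ((dM3 hn m b a).1 h3), hx, hx]
    · have h3' : ¬ DMatrix n a b = 3 := by rw [(DMatrix n).symmetric]; exact h3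
      rw [if_neg h, if_neg h', if_neg h3', if_neg (fun hh => h3 ((dM3 hn m b a).2 hh)), hx]

lemma Grow.numbers (hn : 2 ≤ n) {m i c} (h : Grow n (EE n) m i c) :
    cs.IsReduced c.reverse ∧
      ∀ b, act cs dM23 (x0 n) (cs.wordProd c.reverse) b = num n m i (co n m b) := by
  have ext : ∀ (l : List (Fin (n+3))) a, cs.IsReduced l →
      0 < act cs dM23 (x0 n) (cs.wordProd l) a → cs.IsReduced (l ++ [a]) := by
    intro l a hl hpos
    have := act_pos dM23 (x0 n) x0_nonneg _ _ hpos
    unfold CoxeterSystem.IsReduced at *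
    rw [cs.wordProd_append, cs.wordProd_singleton, this, hl]
    simp
  induction h with
  | start =>
    have h0 : (dv n 0).val = 0 := dv_val_s16 (by omega)
    have h1 : (dv n 1).val = 1 := dv_val_s16 (by omega)
    have e : (EE n).reverse = ([] ++ [dv n 1]) ++ [dv n 0] := by simp [EE]
    have a0 : act cs dM23 (x0 n) (cs.wordProd []) = x0 n := by simp [act_one]
    have a1 : ∀ b : Fin (n+3), act cs dM23 (x0 n) (cs.wordProd ([] ++ [dv n 1])) b =
        if b.val = 0 then 1 else if b.val = 1 then -1 else if b.val = 2 then 1 else 0 := by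
      intro b
      rw [cs.wordProd_append, cs.wordProd_singleton, act_mul_simple, a0,
        fire_co hn 0 _ b _ (fun j => if j ≤ 1 then 1 else 0) (fun b => by simp [x0, co_zero])]
      rw [co_zero, co_zero, h1]
      exact num_b1 hn _
    rw [e]
    constructor
    · apply ext
      · apply ext
        · simp [CoxeterSystem.IsReduced]
        · rw [a0]; simp [x0, h1]
      · rw [a1]; simp [h0]
    · intro b
      rw [cs.wordProd_append, cs.wordProd_singleton, act_mul_simple,
        fire_co hn 0 _ b _ (fun j => if j = 0 then 1 else if j = 1 then -1 else if j = 2 then 1 else 0)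
        (fun b => by rw [a1, co_zero])]
      rw [co_zero, co_zero, h0]
      exact num_b2 hn _
  | @run m i c a h hi hin ha ih =>
    rw [List.reverse_cons]
    refine ⟨ext _ _ ih.1 ?_, fun b => ?_⟩
    · rw [ih.2, ha]
      unfold num
      split_ifs <;> omega
    · rw [cs.wordProd_append, cs.wordProd_singleton, act_mul_simple,
        fire_co hn m a b _ (num n m i) ih.2, ha, num_run hn hi hin (co_le b)]
  | @half m c a h ha ih =>
    have hal := co_le (m := m) a
    rw [List.reverse_cons]
    refine ⟨ext _ _ ih.1 ?_, fun b => ?_⟩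
    · rw [ih.2]
      unfold num
      split_ifs <;> omega
    · rw [cs.wordProd_append, cs.wordProd_singleton, act_mul_simple,
        fire_co hn m a b _ (num n m n) ih.2, num_half hn ha hal (co_le b)]
  | @full m x c a h hx ha ih =>
    have hal := co_le (m := m) a
    have hbd := h.bd hn
    rw [List.reverse_cons]
    refine ⟨ext _ _ ih.1 ?_, fun b => ?_⟩
    · rw [ih.2]
      unfold num
      split_ifs <;> omega
    · rw [cs.wordProd_append, cs.wordProd_singleton, act_mul_simple,
        fire_co hn m a b _ (num n m x) ih.2, co_succ,
        num_full hn hx (q := co n m a) (by omega) ha (co_le b)]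

lemma Grow.reduced (hn : 2 ≤ n) {m i c} (h : Grow n (EE n) m i c) : cs.IsReduced c := by
  simpa using (h.numbers cs hn).1.reverse

end Numbers
section Products

variable {n : ℕ} {W : Type*} [Group W] (cs : CoxeterSystem (DMatrix n) W)

/-- Product of a run. -/
def RP (m : ℕ) : ℕ → W
  | 0 => 1
  | j + 1 => cs.simple (ph n m (j+2)) * RP m j

/-- Product of a full zigzag. -/
def FP : ℕ → W
  | 0 => cs.simple (dv n 0) * cs.simple (dv n 1)
  | m + 1 => cs.simple (ph n m (n+1)) * (cs.simple (ph n m (n+2)) * (RP cs m (n-1) * FP m))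

lemma ph_comm (hn : 2 ≤ n) (m : ℕ) :
    cs.simple (ph n m (n+1)) * cs.simple (ph n m (n+2)) =
      cs.simple (ph n m (n+2)) * cs.simple (ph n m (n+1)) := by
  apply simple_comm
  rw [dM2 hn m, co_ph (by omega), co_ph (by omega)]
  unfold DAdj DHalf
  omega

lemma Grow.prod (hn : 2 ≤ n) {m i c} (h : Grow n (EE n) m i c) :
    (i ≤ n → cs.wordProd c = RP cs m (i-1) * FP cs m ∧ c.length = 2 + (n+1) * m + (i-1)) ∧
    (n + 1 ≤ i → cs.wordProd c = cs.simple (ph n m i) * (RP cs m (n-1) * FP cs m) ∧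
      c.length = 2 + (n+1) * m + n) := by
  induction h with
  | start =>
    refine ⟨fun _ => ?_, by omega⟩
    simp [RP, FP, EE, cs.wordProd_cons]
  | @run m i c a h hi hin ha ih =>
    refine ⟨fun _ => ?_, by omega⟩
    obtain ⟨h1, h2⟩ := ih.1 hin.le
    obtain ⟨j, rfl⟩ : ∃ j, i = j + 1 := ⟨i - 1, by omega⟩
    rw [cs.wordProd_cons, h1, List.length_cons, h2, eq_ph ha]
    simp only [Nat.add_sub_cancel, RP, mul_assoc]
    exact ⟨trivial, by omega⟩
  | @half m c a h ha ih =>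
    refine ⟨by omega, fun _ => ?_⟩
    obtain ⟨h1, h2⟩ := ih.1 le_rfl
    rw [cs.wordProd_cons, h1, List.length_cons, h2, ← eq_ph (a := a) rfl]
    exact ⟨rfl, by omega⟩
  | @full m x c a h hx ha ih =>
    refine ⟨fun _ => ?_, by omega⟩
    obtain ⟨h1, h2⟩ := ih.2 hx
    have hal := co_le (m := m) a
    have hbd := h.bd hn
    rw [cs.wordProd_cons, h1, List.length_cons, h2]
    refine ⟨?_, by ring⟩
    simp only [Nat.sub_self, RP, one_mul, FP]
    have hc := ph_comm cs hn m
    rcases Nat.lt_or_ge x (n+2) with h3 | h3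
    · obtain rfl : x = n + 1 := by omega
      rw [eq_ph (a := a) (m := m) (j := n+2) (by omega), ← mul_assoc, ← hc, mul_assoc]
    · obtain rfl : x = n + 2 := by omega
      rw [eq_ph (a := a) (m := m) (j := n+1) (by omega)]

lemma RP_even (m : ℕ) (hm : m % 2 = 0) (j : ℕ) :
    RP cs m j = cs.wordProd ((List.range' 2 j).map (dv n)).reverse := by
  induction j with
  | zero => simp [RP]
  | succ j ih =>
    rw [RP, ih, List.range'_concat]
    simp [cs.wordProd_cons, ph, hm, add_comm]

lemma RP_odd (m : ℕ) (hm : m % 2 = 1) (j : ℕ) (hj : j ≤ n) :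
    RP cs m j = cs.wordProd ((List.range' (n+1-j) j).map (dv n)) := by
  induction j with
  | zero => simp [RP]
  | succ j ih =>
    rw [RP, ih (by omega), List.range'_succ, show n + 1 - (j+1) + 1 = n + 1 - j by omega,
      List.map_cons, cs.wordProd_cons]
    simp only [ph, hm]
    congr 2
    rw [if_neg (by omega)]
    congr 1
    omega

/-- The product `s_2 ... s_n`. -/
def UP : W := cs.wordProd ((List.range' 2 (n-1)).map (dv n))

/-- First involution. -/
def PP : W := cs.simple (dv n 0) * cs.simple (dv n 1)

/-- Second involution. -/
def QQ : W := UP cs * (cs.simple (dv n (n+1)) * cs.simple (dv n (n+2))) * (UP cs)⁻¹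

lemma PP_comm (hn : 2 ≤ n) : PP cs = cs.simple (dv n 1) * cs.simple (dv n 0) := by
  apply simple_comm
  rw [dM2 hn 0, co_zero, co_zero, dv_val_s16 (by omega), dv_val_s16 (by omega)]
  unfold DAdj DHalf
  omega

lemma PP_inv (hn : 2 ≤ n) : (PP cs)⁻¹ = PP cs := by
  rw [PP_comm cs hn, mul_inv_rev, cs.inv_simple, cs.inv_simple]
  exact PP_comm cs hn

lemma QQ_inv (hn : 2 ≤ n) : (QQ cs)⁻¹ = QQ cs := by
  have := ph_comm cs hn 0
  simp only [ph, Nat.zero_mod, if_true] at this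
  unfold QQ
  simp only [mul_inv_rev, cs.inv_simple, inv_inv]
  rw [← this]
  simp only [mul_assoc]

lemma FP_even (hn : 2 ≤ n) (k : ℕ) : FP cs (2*k) = (PP cs * QQ cs)^k * PP cs := by
  induction k with
  | zero => simp [FP, PP]
  | succ k ih =>
    rw [show 2 * (k+1) = 2*k+1+1 by ring, FP, FP, ih, pow_succ']
    rw [RP_even cs (2*k) (by omega), RP_odd cs (2*k+1) (by omega) (n-1) (by omega),
      show n + 1 - (n-1) = 2 by omega, cs.wordProd_reverse]
    have e1 : ph n (2*k+1) (n+1) = dv n 1 := by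
      simp [ph, show (2*k+1) % 2 = 1 by omega]
    have e2 : ph n (2*k+1) (n+2) = dv n 0 := by
      simp [ph, show (2*k+1) % 2 = 1 by omega]
    have e3 : ∀ j, ph n (2*k) j = dv n j := by
      intro j; simp [ph, show (2*k) % 2 = 0 by omega]
    rw [e1, e2, e3, e3]
    change _ * (_ * (UP cs * (_ * (_ * ((UP cs)⁻¹ * _))))) = _
    unfold QQ
    rw [← mul_assoc, ← PP_comm cs hn]
    simp only [mul_assoc]

lemma wordProd_A (hn : 2 ≤ n) : cs.wordProd (AWord n) =
    UP cs * (cs.simple (dv n (n+1)) * cs.simple (dv n (n+2))) := by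
  unfold AWord UP
  rw [show n + 1 = (n - 1) + 2 by omega, ← List.range'_append_1]
  rw [List.map_append, cs.wordProd_append]
  congr 1
  simp [cs.wordProd_cons, List.range'_succ, show 2 + (n-1) = n+1 by omega, show n - 1 + 2 = n+1 by omega]

lemma wordProd_B (hn : 2 ≤ n) : cs.wordProd (BWord n) = (UP cs)⁻¹ * PP cs := by
  unfold BWord UP
  rw [PP_comm cs hn, List.map_reverse, cs.wordProd_reverse, List.range_eq_range',
    show n + 1 = 2 + (n - 1) by omega, ← List.range'_append_1, List.map_append, cs.wordProd_append,
    mul_inv_rev]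
  congr 1
  simp [cs.wordProd_cons, List.range'_succ]

lemma wordProd_zig (hn : 2 ≤ n) (k : ℕ) : cs.wordProd (ZigWord1 n k 0) = FP cs (2*k) := by
  rw [FP_even cs hn]
  unfold ZigWord1
  have h1 : cs.wordProd (AWord n ++ BWord n) = QQ cs * PP cs := by
    rw [cs.wordProd_append, wordProd_A cs hn, wordProd_B cs hn]
    unfold QQ
    simp only [mul_assoc]
  have h2 : cs.wordProd (List.replicate k (AWord n ++ BWord n)).flatten = (QQ cs * PP cs)^k := by
    induction k with
    | zero => simp
    | succ k ih =>
      rw [List.replicate_succ, List.flatten_cons, cs.wordProd_append, ih, h1, pow_succ']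
  simp only [List.replicate_zero, List.flatten_nil, List.append_nil]
  rw [cs.wordProd_append, h2]
  have : cs.wordProd [dv n 0, dv n 1] = PP cs := by simp [cs.wordProd_cons, PP]
  rw [this]
  clear h2
  induction k with
  | zero => simp
  | succ k ih =>
    rw [pow_succ, pow_succ', ← mul_assoc, ih]
    rw [← pow_succ', pow_succ]
    simp only [mul_assoc]

lemma length_zig (k : ℕ) : (ZigWord1 n k 0).length = 2 + (n+1) * (2*k) := by
  unfold ZigWord1 AWord BWord
  simp
  ring

lemma FP_inv (hn : 2 ≤ n) (k : ℕ) : (FP cs (2*k))⁻¹ = FP cs (2*k) := by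
  rw [FP_even cs hn]
  rw [mul_inv_rev, PP_inv cs hn, ← inv_pow, mul_inv_rev, PP_inv cs hn, QQ_inv cs hn]
  induction k with
  | zero => simp
  | succ k ih =>
    rw [pow_succ, ← mul_assoc, ih, pow_succ]
    simp only [mul_assoc]

lemma FP_mul (hn : 2 ≤ n) (k k' : ℕ) :
    FP cs (2*k) * PP cs * FP cs (2*k') = FP cs (2*(k+k')) := by
  have : PP cs * PP cs = 1 := by
    nth_rw 1 [← PP_inv cs hn]; simp
  rw [FP_even cs hn, FP_even cs hn, FP_even cs hn, mul_assoc ((PP cs * QQ cs)^k), this, mul_one,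
    pow_add, mul_assoc]

lemma Grow.prod_even (hn : 2 ≤ n) {k c} (h : Grow n (EE n) (2*k) 1 c) :
    cs.wordProd c = FP cs (2*k) ∧ c.length = 2 + (n+1) * (2*k) := by
  have := (h.prod cs hn).1 (by omega)
  simpa [RP] using this

lemma zig_reduced (hn : 2 ≤ n) (k : ℕ) : cs.IsReduced (ZigWord1 n k 0) := by
  obtain ⟨c, hc⟩ := Grow.exists_all (c0 := EE n) hn (2*k)
  have h1 := hc.reduced cs hn
  obtain ⟨h2, h3⟩ := hc.prod_even cs hn
  unfold CoxeterSystem.IsReduced at *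
  rw [wordProd_zig cs hn, length_zig, ← h2, h1, h3]

end Products
section Final

variable {n : ℕ} {W : Type*} [Group W] {cs : CoxeterSystem (DMatrix n) W} {w : W}

lemma backward (hn : 2 ≤ n) (hw : IsFC cs w) (hirr : LeftStarIrreducible cs w)
    (u : List (Fin (n+3))) : ∀ m i c v, Grow n (EE n) m i c → Red cs w (u ++ (c ++ v)) →
    (∃ m' c' v', 0 < m' ∧ Grow n (EE n) m' 1 c' ∧ Red cs w (c' ++ v')) ∨
    (m = 0 ∧ i = 1 ∧ dv n 0 ∉ u ∧ ∃ v', Red cs w (c ++ v')) := by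
  induction u using List.reverseRecOn with
  | nil =>
    intro m i c v hg hr
    rw [List.nil_append] at hr
    by_cases hi : i = 1
    · subst hi
      rcases Nat.eq_zero_or_pos m with hm | hm
      · exact Or.inr ⟨hm, rfl, by simp, v, hr⟩
      · exact Or.inl ⟨m, c, v, hm, hg, hr⟩
    · obtain ⟨a, b, r, rfl, hab⟩ := hg.head2 hn hi
      exact (Red.not_irr hr hab hirr).elim
  | append_singleton u b ih =>
    intro m i c v hg hr
    have hr1 : Red cs w (u ++ b :: (c ++ v)) := by simpa using hr
    rcases hg.step hn (inv_EE hn) b with ⟨m', i', hne, hg'⟩ | h | h | h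
    · rcases ih m' i' (b :: c) v hg' (by simpa using hr1) with h1 | ⟨h1, h2, -⟩
      · exact Or.inl h1
      · omega
    · exact (hr1.no_st0 h).elim
    · exact (hr1.no_st1 hw h).elim
    · rcases ih m i c (b :: v) hg (hr1.move h) with h1 | ⟨rfl, rfl, h3, h4⟩
      · exact Or.inl h1
      · refine Or.inr ⟨rfl, rfl, ?_, h4⟩
        have hc := hg.zero_one hn
        subst hc
        intro hmem
        rcases List.mem_append.1 hmem with h5 | h5
        · exact h3 h5
        · rw [List.mem_singleton] at h5
          have := h b (by rw [← h5]; simp [EE])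
          rw [(DMatrix n).diagonal] at this
          omega

lemma forward (hn : 2 ≤ n) (hw : IsFC cs w) {c0 : List (Fin (n+3))}
    (h0 : Inv (ZS n 0 1) (AS n 0 1) c0) (hall : ∀ b, b ∈ c0) (v : List (Fin (n+3))) :
    ∀ m i c, Grow n c0 m i c → Red cs w (c.reverse ++ v) →
    ∃ m' i' c', Grow n c0 m' i' c' ∧ Red cs w c'.reverse := by
  induction v with
  | nil =>
    intro m i c hg hr
    exact ⟨m, i, c, hg, by simpa using hr⟩
  | cons b v ih =>
    intro m i c hg hr
    rcases hg.step hn h0 b with ⟨m', i', -, hg'⟩ | h | h | h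
    · exact ih m' i' (b :: c) hg' (by simpa using hr)
    · exact (hr.no_end hw (Or.inl h)).elim
    · exact (hr.no_end hw (Or.inr h)).elim
    · obtain ⟨f, rfl, -⟩ := hg.base
      have := h b (by simp [hall b])
      rw [(DMatrix n).diagonal] at this
      omega

lemma weak (hn : 2 ≤ n) (hw : IsFC cs w) {m : ℕ} {c v : List (Fin (n+3))} (hm : 0 < m)
    (hg : Grow n (EE n) m 1 c) (hr : Red cs w (c ++ v)) : IsWeakZigzag cs w := by
  have hall : ∀ b, b ∈ c := fun b => ((hg.shape hn).1 b (Or.inl hm)).1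
  have hr0 : Red cs w (c.reverse.reverse ++ v) := by simpa using hr
  obtain ⟨m', i', c', hg', hr'⟩ := forward hn hw (hg.inv_reverse hn hm) (by simpa using hall) v
    0 1 _ Grow.start hr0
  obtain ⟨f, rfl, hf⟩ := hg'.base
  obtain ⟨x, k, hx⟩ := hg.progress hn
  obtain ⟨y, k', hy⟩ := (hf (EE n)).progress hn
  obtain ⟨x1, x2⟩ := hx.prod_even cs hn
  obtain ⟨y1, y2⟩ := hy.prod_even cs hn
  have hcl := ((hg.prod cs hn).1 (by omega)).2
  have hr2 : Red cs w (c ++ f.reverse) := by simpa using hr'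
  have hk : 0 < k := by
    rcases Nat.eq_zero_or_pos k with rfl | hk
    · have : 0 < (n+1) * m := Nat.mul_pos (by omega) hm
      simp at x2
      omega
    · exact hk
  have hEE : cs.wordProd (EE n) = PP cs := by simp [EE, PP, cs.wordProd_cons]
  have hEEl : (EE n).length = 2 := rfl
  have hyf : cs.wordProd y * cs.wordProd f = FP cs (2*k') * PP cs := by
    rw [cs.wordProd_append, cs.wordProd_append, hEE, ← mul_assoc] at y1
    rw [← y1, mul_assoc, mul_assoc]
    nth_rw 2 [← PP_inv cs hn]
    simp
  have hprod : cs.wordProd (x ++ c) * (cs.wordProd f.reverse * cs.wordProd y.reverse) =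
      FP cs (2*(k+k')) := by
    rw [x1, cs.wordProd_reverse, cs.wordProd_reverse, ← mul_inv_rev, hyf, mul_inv_rev, PP_inv cs hn,
      FP_inv cs hn, ← mul_assoc, FP_mul cs hn]
  have hz : FP cs (2*(k+k')) = cs.wordProd x * w * cs.wordProd y.reverse := by
    rw [← hprod, ← hr2.2, cs.wordProd_append, cs.wordProd_append]
    simp only [mul_assoc]
  have hlen : cs.length (FP cs (2*(k+k'))) = x.length + (c ++ f.reverse).length + y.length := by
    have := zig_reduced cs hn (k+k')
    unfold CoxeterSystem.IsReduced at this
    rw [wordProd_zig cs hn, length_zig] at this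
    rw [this]
    simp only [List.length_append, List.length_reverse, hEEl] at x2 y2 ⊢
    have : (n+1) * (2*(k+k')) = (n+1)*(2*k) + (n+1)*(2*k') := by ring
    omega
  have hwl : cs.length w = (c ++ f.reverse).length := by
    rw [← hr2.2]; exact hr2.1
  refine ⟨⟨FP cs (2*(k+k')), cs.wordProd x, cs.wordProd y.reverse, ?_, hz, ?_⟩, ?_⟩
  · exact ⟨k+k', 0, by omega, by omega, Or.inl ⟨zig_reduced cs hn _, wordProd_zig cs hn _⟩⟩
  · have l1 := cs.length_wordProd_le x
    have l2 := cs.length_wordProd_le y.reverse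
    have l3 := cs.length_mul_le (cs.wordProd x * w) (cs.wordProd y.reverse)
    have l4 := cs.length_mul_le (cs.wordProd x) w
    rw [← hz] at l3
    rw [List.length_reverse] at l2
    omega
  · rintro ⟨l, hl1, hl2, hl3⟩
    have hp := Red.perm hw hr (show Red cs w l from ⟨hl1, hl2⟩)
    have hmem : ∀ b, b ∈ l := fun b => hp.subset (by simp [hall b])
    have h0 : (dv n 0).val = 0 := dv_val_s16 (by omega)
    have h2 : (dv n 2).val = 2 := dv_val_s16 (by omega)
    have := hl3 (dv n 0) (hmem _) (dv n 2) (hmem _) (fun h => by rw [h] at h0; omega)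
    rw [dM2 hn 0, co_zero, co_zero, h0, h2] at this
    exact this.2 (by unfold DAdj DHalf; omega)

lemma occ {a b : Fin (n+3)} {l : List (Fin (n+3))} {i : ℕ} (hi : i + 1 < l.length)
    (h : ((l.getD i a == a) && (l.getD (i+1) b == b)) = true) :
    l = l.take i ++ ([a, b] ++ l.drop (i+2)) := by
  simp only [Bool.and_eq_true, beq_iff_eq] at h
  obtain ⟨h1, h2⟩ := h
  rw [List.getD_eq_getElem _ _ (by omega)] at h1 h2
  conv_lhs => rw [← List.take_append_drop i l, List.drop_eq_getElem_cons (by omega),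
    List.drop_eq_getElem_cons (by omega), h1, h2]
  simp

lemma count_two {p : ℕ → Bool} {N : ℕ} (h : 2 ≤ (List.range N).countP p) :
    ∃ i j, i < j ∧ j < N ∧ p i = true ∧ p j = true := by
  induction N with
  | zero => simp at h
  | succ N ih =>
    rw [List.range_succ, List.countP_append, List.countP_singleton] at h
    by_cases hN : p N = true
    · rw [if_pos hN] at h
      have : 0 < (List.range N).countP p := by omega
      rw [List.countP_pos_iff] at this
      obtain ⟨i, hi, hp⟩ := this
      exact ⟨i, N, List.mem_range.1 hi, by omega, hp, hN⟩
    · rw [if_neg hN] at h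
      obtain ⟨i, j, h1, h2, h3⟩ := ih (by omega)
      exact ⟨i, j, h1, by omega, h3⟩

lemma count_le (hn : 2 ≤ n) (hw : IsFC cs w) (hirr : LeftStarIrreducible cs w)
    (hwz : ¬ IsWeakZigzag cs w) {l : List (Fin (n+3))} (hl : Red cs w l) :
    CountFactor (dv n 0) (dv n 1) l ≤ 1 := by
  by_contra hcon
  unfold CountFactor at hcon
  obtain ⟨i, j, hij, hj, hi1, hj1⟩ := count_two (Nat.lt_of_not_le hcon)
  have e := occ (by omega) hj1
  have hl2 := hl
  rw [e] at hl2
  rcases backward hn hw hirr _ 0 1 (EE n) _ Grow.start hl2 with ⟨m, c, v, hm, hg, hr⟩ | ⟨-, -, h, -⟩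
  · exact hwz (weak hn hw hm hg hr)
  · apply h
    simp only [Bool.and_eq_true, beq_iff_eq] at hi1
    have h1 := hi1.1
    rw [List.getD_eq_getElem _ _ (by omega)] at h1
    rw [List.mem_take_iff_getElem]
    exact ⟨i, by omega, h1⟩

end Final
theorem stmt16 (n : ℕ) (hn : 2 ≤ n) {W : Type*} [Group W]
    (cs : CoxeterSystem (DMatrix n) W) (w : W) (hw : IsFC cs w)
    (hirr : LeftStarIrreducible cs w)
    (hf : fBullet cs w ≠ 0) (hwz : ¬ IsWeakZigzag cs w) :
    cs.IsLeftDescent w (dv n 0) ∧ cs.IsLeftDescent w (dv n 1) ∧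
      fBullet cs w = 1 := by
  have hle : fBullet cs w ≤ 1 := by
    unfold fBullet
    apply csSup_le'
    rintro c ⟨l, h1, h2, rfl⟩
    exact count_le hn hw hirr hwz ⟨h1, h2⟩
  obtain ⟨l, hl, hc⟩ : ∃ l, Red cs w l ∧ CountFactor (dv n 0) (dv n 1) l ≠ 0 := by
    by_contra hcon
    push Not at hcon
    apply hf
    apply Nat.le_zero.1
    unfold fBullet
    apply csSup_le'
    rintro c ⟨l, h1, h2, rfl⟩
    exact (hcon l ⟨h1, h2⟩).le
  unfold CountFactor at hc
  have hpos := Nat.pos_of_ne_zero hc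
  rw [List.countP_pos_iff] at hpos
  obtain ⟨i, hi, hp⟩ := hpos
  rw [List.mem_range] at hi
  have e := occ (by omega) hp
  rw [e] at hl
  rcases backward hn hw hirr _ 0 1 (EE n) _ Grow.start hl with
    ⟨m, c, v, hm, hg, hr⟩ | ⟨-, -, -, v, hr⟩
  · exact absurd (weak hn hw hm hg hr) hwz
  · have h1 : Red cs w (dv n 0 :: dv n 1 :: v) := hr
    have h2 : Red cs w (dv n 1 :: dv n 0 :: v) := by
      refine h1.congr (by simp) ?_
      rw [cs.wordProd_cons, cs.wordProd_cons, cs.wordProd_cons, cs.wordProd_cons, ← mul_assoc,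
        ← mul_assoc]
      congr 1
      exact (PP_comm cs hn).symm
    exact ⟨h1.descent.1, h2.descent.1, by omega⟩


end CoxFC
end
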